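/- arXiv:math/0206182 — 3 statements merged into one kernel-verified Lean document; each statement's English description precedes it below -/
import Mathlib

section
/- For p = 4 (and more generally p ∈ {4,6,8,…}), there exist two 2-dimensional subspaces A and B of L_p[0,1], both isometric to the 2-dimensional Euclidean space, whose relative projection constants differ: λ(A ↪ L_p) ≠ λ(B ↪ L_p). -/
open MeasureTheory
open scoped ENNReal

/-- The relative projection constant of a subspace `Y` of `X`:
the infimum of norms of bounded linear projections of `X` onto `Y`. -/
noncomputable def relProjConst {X : Type*} [NormedAddCommGroup X] [NormedSpace ℝ X]
    (Y : Submodule ℝ X) : ℝ :=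
  sInf {c | ∃ P : X →L[ℝ] X, (∀ x, P x ∈ Y) ∧ (∀ y ∈ Y, P y = y) ∧ c = ‖P‖}


/-- sum over the `m` equally spaced angles -/
noncomputable def GG (m : ℕ) (g : ℝ → ℝ) (a : ℝ) : ℝ :=
  ∑ k ∈ Finset.range m, g (a + k * (Real.pi / m))

lemma GG_periodic (m : ℕ) (hm : 0 < m) (g : ℝ → ℝ) (hg : Function.Periodic g Real.pi) :
    Function.Periodic (GG m g) (Real.pi / m) := by
  intro a
  unfold GG
  have h1 := Finset.sum_range_succ (fun k : ℕ => g (a + k * (Real.pi / m))) m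
  have h2 := Finset.sum_range_succ' (fun k : ℕ => g (a + k * (Real.pi / m))) m
  have hm' : (m : ℝ) ≠ 0 := by positivity
  have h3 : g (a + m * (Real.pi / m)) = g a := by
    rw [mul_div_cancel₀ _ hm']; exact hg a
  have h4 : ∀ k : ℕ, g (a + Real.pi / m + k * (Real.pi / m)) = g (a + (k + 1 : ℕ) * (Real.pi / m)) := by
    intro k; congr 1; push_cast; ring
  simp only [h4]
  simp only [Nat.cast_zero, zero_mul, add_zero] at h2
  linarith

lemma GG_shift (m : ℕ) (hm : 0 < m) (g : ℝ → ℝ) (hg : Function.Periodic g Real.pi) (a : ℝ) (j : ℤ) :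
    GG m g (a + j * (Real.pi / m)) = GG m g a :=
  (GG_periodic m hm g hg).int_mul j a

lemma per_int (g : ℝ → ℝ) (hg : Function.Periodic g Real.pi) (b : ℝ) :
    ∫ t in (0:ℝ)..1, g (Real.pi * t + b) = ∫ t in (0:ℝ)..1, g (Real.pi * t) := by
  have hper : Function.Periodic (fun t => g (Real.pi * t)) 1 := by
    intro t
    simp only [mul_add, mul_one]
    exact hg _
  have h := hper.intervalIntegral_add_eq 0 (b / Real.pi)
  have h2 := intervalIntegral.integral_comp_add_right (a := 0) (b := 1)
    (fun t => g (Real.pi * t)) (b / Real.pi)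
  simp only [zero_add, add_comm (1:ℝ)] at h h2
  rw [h, ← h2]
  congr 1
  ext t
  congr 1
  field_simp

lemma int_GG (m : ℕ) (g : ℝ → ℝ) (hg : Function.Periodic g Real.pi) (hc : Continuous g) :
    ∫ t in (0:ℝ)..1, GG m g (Real.pi * t) = m * ∫ t in (0:ℝ)..1, g (Real.pi * t) := by
  unfold GG
  rw [intervalIntegral.integral_finsetSum]
  · simp [per_int g hg]
  · intro i _
    exact Continuous.intervalIntegrable (by fun_prop) _ _

/-- the step angle function -/
noncomputable def th (m : ℕ) (t : ℝ) : ℝ := (⌊m * t⌋ : ℤ) * (Real.pi / m)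

lemma th_meas (m : ℕ) : Measurable (th m) := by
  unfold th
  have : Measurable (fun t : ℝ => ⌊(m:ℝ) * t⌋) := Int.measurable_floor.comp (measurable_const.mul measurable_id)
  exact (measurable_from_top.comp this).mul_const _

lemma int_th (m : ℕ) (hm : 0 < m) (g : ℝ → ℝ) (a : ℝ) :
    ∫ t in (0:ℝ)..1, g (a + th m t) = GG m g a / m := by
  have hm' : (0 : ℝ) < m := by positivity
  have key : ∀ k : ℕ, Set.EqOn (fun t => g (a + th m t)) (fun _ => g (a + k * (Real.pi / m)))
      (Set.Ioo ((k:ℝ)/m) (((k+1 : ℕ):ℝ)/m)) := by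
    intro k t ht
    have : ⌊(m:ℝ) * t⌋ = k := by
      rw [Int.floor_eq_iff]
      have h1 := (div_lt_iff₀ hm').1 ht.1
      have h2 := (lt_div_iff₀ hm').1 ht.2
      push_cast at *
      constructor <;> linarith
    simp [th, this]
  have hle : ∀ k : ℕ, (k:ℝ)/m ≤ ((k+1 : ℕ):ℝ)/m := by
    intro k; gcongr; simp
  have h := intervalIntegral.sum_integral_adjacent_intervals (μ := volume)
    (f := fun t => g (a + th m t)) (a := fun k : ℕ => (k:ℝ)/m) (n := m) (by
      intro k _
      have := (intervalIntegrable_const (μ := volume) (a := (k:ℝ)/m) (b := ((k+1 : ℕ):ℝ)/m)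
        (c := g (a + k * (Real.pi / m))))
      refine this.congr_ae ?_
      rw [Set.uIoc_of_le (hle k), ← restrict_Ioo_eq_restrict_Ioc]
      refine (ae_restrict_iff' measurableSet_Ioo).2 (Filter.Eventually.of_forall ?_)
      intro t ht; exact (key k ht).symm)
  simp only [Nat.cast_zero, zero_div, div_self hm'.ne'] at h
  rw [← h, GG, Finset.sum_div]
  refine Finset.sum_congr rfl fun k _ => ?_
  rw [intervalIntegral.integral_of_le (hle k), integral_Ioc_eq_integral_Ioo,
    setIntegral_congr_fun measurableSet_Ioo (key k)]
  simp only [integral_const, MeasurableSet.univ, measureReal_restrict_apply, Set.univ_inter,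
    smul_eq_mul]
  rw [Real.volume_real_Ioo_of_le (hle k)]
  push_cast; field_simp; ring

lemma GG_cos_pow (n : ℕ) (a : ℝ) :
    GG (n+1) (fun x => Real.cos x ^ (2*n)) a = (n+1) * ((2*n).choose n) / 4^n := by
  have hc : ∀ x : ℝ, ((Real.cos x ^ (2*n) : ℝ) : ℂ) =
      (∑ j ∈ Finset.range (2*n+1), ((2*n).choose j) * Complex.exp (2 * ((j:ℂ) - n) * x * Complex.I)) / 4^n := by
    intro x
    push_cast
    rw [Complex.cos, div_pow, add_pow, pow_mul 2 2 n]
    norm_num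
    refine Finset.sum_congr rfl fun j hj => ?_
    have hj' : j ≤ 2*n := by simpa [Nat.lt_succ_iff] using hj
    rw [← Complex.exp_nat_mul, ← Complex.exp_nat_mul, ← Complex.exp_add, mul_comm]
    congr 2
    rw [Nat.cast_sub hj']; push_cast; ring
  have : ((GG (n+1) (fun x => Real.cos x ^ (2*n)) a : ℝ) : ℂ) =
      (((n+1) * ((2*n).choose n) / 4^n : ℝ) : ℂ) := by
    unfold GG
    rw [Complex.ofReal_sum]
    simp only [hc]
    rw [← Finset.sum_div, Finset.sum_comm]
    push_cast
    congr 1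
    rw [Finset.sum_eq_single n]
    · simp
    · intro j hj hjn
      have hj' : j ≤ 2*n := by simpa [Nat.lt_succ_iff] using hj
      have hn1 : ((n:ℂ)+1) ≠ 0 := by exact_mod_cast Nat.succ_ne_zero n
      set w : ℂ := Complex.exp (2 * ((j:ℂ) - n) * (Real.pi / (n+1)) * Complex.I) with hw
      have hw1 : w ≠ 1 := by
        intro h
        obtain ⟨N, hN⟩ := Complex.exp_eq_one_iff.1 h
        have hpi : (Real.pi : ℂ) ≠ 0 := by exact_mod_cast Real.pi_ne_zero
        have h2 : ((j:ℂ) - n) = N * (n+1) := by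
          field_simp at hN
          linear_combination hN
        have h3 : ((j:ℤ) - n) = N * (n+1) := by exact_mod_cast h2
        have hN0 : N ≠ 0 := by
          rintro rfl
          simp at h3; omega
        rcases lt_or_gt_of_ne hN0 with h4 | h4
        · nlinarith
        · nlinarith
      have hwm : w ^ (n+1) = 1 := by
        rw [hw, ← Complex.exp_nat_mul, Complex.exp_eq_one_iff]
        refine ⟨(j:ℤ) - n, ?_⟩
        push_cast; field_simp
      have hgs : ∑ k ∈ Finset.range (n+1), w^k = 0 := by
        rw [geom_sum_eq hw1, hwm]; simp
      rw [← Finset.mul_sum]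
      have : ∀ k ∈ Finset.range (n+1), Complex.exp (2 * ((j:ℂ) - n) * ((a + (k:ℝ) * (Real.pi / ((n+1:ℕ):ℝ)) : ℝ) : ℂ) * Complex.I)
          = Complex.exp (2 * ((j:ℂ) - n) * a * Complex.I) * w^k := by
        intro k _
        rw [hw, ← Complex.exp_nat_mul, ← Complex.exp_add]
        congr 1; push_cast; ring
      push_cast at this
      rw [Finset.sum_congr rfl this, ← Finset.mul_sum, hgs]; simp
    · intro h; simp at h; omega
  exact_mod_cast this

lemma kink (m : ℕ) (hm : 0 < m) (q : ℝ) (h1 : 1 < q) (h2 : q < 2) :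
    ∃ a b, GG m (fun x => |Real.cos x| ^ q) a ≠ GG m (fun x => |Real.cos x| ^ q) b := by
  by_contra! hcon
  have hm' : (0:ℝ) < m := by positivity
  have hm1 : (1:ℝ) ≤ m := by exact_mod_cast hm
  set s : ℝ := (1/(2*m)) ^ (1/(2-q)) with hs
  have hs0 : 0 < s := by positivity
  have hs1 : s ≤ 1 := Real.rpow_le_one (by positivity)
    (by rw [div_le_one (by positivity)]; linarith) (by apply div_nonneg <;> linarith)
  have hsq : s ^ (2-q) = 1/(2*m) := by
    rw [hs, ← Real.rpow_mul (by positivity), one_div_mul_cancel (by linarith), Real.rpow_one]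
  have hss : s^2 = s^q * (1/(2*m)) := by
    rw [← hsq, ← Real.rpow_add hs0, ← Real.rpow_natCast]; norm_num
  set h := Real.arcsin s with hh
  have hsin : Real.sin h = s := Real.sin_arcsin (by linarith) hs1
  have hcos0 : 0 ≤ Real.cos h := Real.cos_arcsin_nonneg s
  have hcos2 : Real.cos h ^ 2 = 1 - s^2 := by rw [← hsin]; linarith [Real.sin_sq_add_cos_sq h]
  have hcq : Real.cos h ^ 2 ≤ Real.cos h ^ q := by
    rcases hcos0.eq_or_lt with h0 | h0
    · rw [← h0, Real.zero_rpow (by linarith)]; simp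
    · rw [← Real.rpow_natCast]
      exact Real.rpow_le_rpow_of_exponent_ge h0 (Real.cos_le_one h) (by push_cast; linarith)
  have conv : ∀ x : ℝ, 2 * |Real.cos x|^q * (1 - s^2) ≤ |Real.cos (x+h)|^q + |Real.cos (x-h)|^q := by
    intro x
    have hc := (convexOn_rpow h1.le).2 (abs_nonneg (Real.cos (x+h))) (abs_nonneg (Real.cos (x-h)))
      (by norm_num : (0:ℝ) ≤ 1/2) (by norm_num : (0:ℝ) ≤ 1/2) (by norm_num)
    simp only [smul_eq_mul] at hc
    have hx : |Real.cos x| * Real.cos h ≤ 1/2 * |Real.cos (x+h)| + 1/2 * |Real.cos (x-h)| := by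
      have : Real.cos x * Real.cos h = 1/2 * (Real.cos (x+h) + Real.cos (x-h)) := by
        rw [Real.cos_add, Real.cos_sub]; ring
      rw [← abs_of_nonneg hcos0, ← abs_mul, this, abs_mul]
      have := abs_add_le (Real.cos (x+h)) (Real.cos (x-h))
      rw [abs_of_nonneg (by norm_num : (0:ℝ) ≤ 1/2)]
      linarith
    have h3 := Real.rpow_le_rpow (by positivity) hx (by linarith : 0 ≤ q)
    rw [Real.mul_rpow (abs_nonneg _) hcos0] at h3
    have h4 : |Real.cos x|^q * (1-s^2) ≤ |Real.cos x|^q * Real.cos h ^ q := by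
      rw [← hcos2]; gcongr
    linarith
  have hb : ∀ x : ℝ, |Real.cos x|^q ≤ 1 := fun x =>
    Real.rpow_le_one (abs_nonneg _) (Real.abs_cos_le_one x) (by linarith)
  obtain ⟨m', rfl⟩ : ∃ m', m = m'+1 := ⟨m-1, by omega⟩
  have e1 := hcon (Real.pi/2 + h) (Real.pi/2)
  have e2 := hcon (Real.pi/2 - h) (Real.pi/2)
  unfold GG at e1 e2
  simp only [Finset.sum_range_succ' _ m'] at e1 e2
  set D := Real.pi / ((m'+1:ℕ):ℝ) with hD
  have c1 : Real.cos (Real.pi/2 + h) = -s := by rw [add_comm, Real.cos_add_pi_div_two, hsin]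
  have c2 : Real.cos (Real.pi/2 - h) = s := by rw [Real.cos_pi_div_two_sub, hsin]
  simp only [Nat.cast_zero, zero_mul, add_zero, c1, c2, Real.cos_pi_div_two, abs_neg, abs_zero,
    Real.zero_rpow (by linarith : q ≠ 0), abs_of_pos hs0] at e1 e2
  have key : ∑ k ∈ Finset.range m', (2 * |Real.cos (Real.pi/2 + ((k+1:ℕ):ℝ)*D)|^q - 2 * s^2) ≤
      ∑ k ∈ Finset.range m', (|Real.cos (Real.pi/2 + h + ((k+1:ℕ):ℝ)*D)|^q + |Real.cos (Real.pi/2 - h + ((k+1:ℕ):ℝ)*D)|^q) := by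
    refine Finset.sum_le_sum fun k _ => ?_
    have := conv (Real.pi/2 + ((k+1:ℕ):ℝ)*D)
    have hb' := hb (Real.pi/2 + ((k+1:ℕ):ℝ)*D)
    have r1 : Real.pi/2 + h + ((k+1:ℕ):ℝ)*D = Real.pi/2 + ((k+1:ℕ):ℝ)*D + h := by ring
    have r2 : Real.pi/2 - h + ((k+1:ℕ):ℝ)*D = Real.pi/2 + ((k+1:ℕ):ℝ)*D - h := by ring
    rw [r1, r2]
    nlinarith [sq_nonneg s]
  rw [Finset.sum_add_distrib, Finset.sum_sub_distrib, ← Finset.mul_sum] at key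
  simp only [Finset.sum_const, Finset.card_range, nsmul_eq_mul] at key
  have hf : (m':ℝ) * s^2 < s^q := by
    have hp : 0 < s^q := by positivity
    rw [hss]
    have : (m':ℝ) * (s^q * (1/(2*((m'+1:ℕ):ℝ)))) = s^q * (m' / (2*((m'+1:ℕ):ℝ))) := by ring
    rw [this]
    have : (m':ℝ) / (2*((m'+1:ℕ):ℝ)) < 1 := by
      rw [div_lt_one (by positivity)]; push_cast; linarith [(Nat.cast_nonneg m' : (0:ℝ) ≤ m')]
    nlinarith
  linarith

lemma absq_periodic (q : ℝ) : Function.Periodic (fun x => |Real.cos x| ^ q) Real.pi := by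
  intro x; simp [Real.cos_add_pi]

lemma exists_gt (m : ℕ) (hm : 0 < m) (q : ℝ) (h1 : 1 < q) (h2 : q < 2) :
    ∃ a, ∫ t in (0:ℝ)..1, |Real.cos (Real.pi * t)| ^ q < GG m (fun x => |Real.cos x| ^ q) a / m := by
  by_contra! hcon
  have hm' : (0:ℝ) < m := by positivity
  set M := ∫ t in (0:ℝ)..1, |Real.cos (Real.pi * t)| ^ q with hM
  set G := GG m (fun x => |Real.cos x| ^ q) with hG
  have hgc : Continuous (fun x => |Real.cos x| ^ q) :=
    Continuous.rpow_const (by fun_prop) (fun x => Or.inr (by linarith))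
  have hGc : Continuous G := by
    rw [hG]; unfold GG
    exact continuous_finsetSum _ fun k _ => hgc.comp (by fun_prop)
  have hintg := int_GG m _ (absq_periodic q) hgc
  have hle : ∀ a, G a ≤ m * M := by
    intro a; have := hcon a; rw [div_le_iff₀ hm'] at this; linarith
  have heq : ∀ t ∈ Set.Icc (0:ℝ) 1, G (Real.pi * t) = m * M := by
    by_contra! h
    obtain ⟨t, ht, hne⟩ := h
    have := intervalIntegral.integral_lt_integral_of_continuousOn_of_le_of_exists_lt
      (f := fun t => G (Real.pi * t)) (g := fun _ => m * M) (zero_lt_one) 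
      (by fun_prop) (by fun_prop) (fun x _ => hle _) ⟨t, ht, lt_of_le_of_ne (hle _) hne⟩
    simp only [intervalIntegral.integral_const, sub_zero, one_smul] at this
    linarith
  have hper : Function.Periodic G Real.pi := by
    have := (GG_periodic m hm _ (absq_periodic q)).nat_mul m
    rwa [mul_div_cancel₀ _ hm'.ne'] at this
  have hall : ∀ a, G a = m * M := by
    intro a
    obtain ⟨y, hy, hy2⟩ := hper.exists_mem_Ico₀ Real.pi_pos a
    rw [hy2]
    have := heq (y / Real.pi) ⟨div_nonneg hy.1 Real.pi_pos.le, (div_le_one Real.pi_pos).2 hy.2.le⟩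
    rwa [mul_div_cancel₀ _ Real.pi_ne_zero] at this
  obtain ⟨a, b, hab⟩ := kink m hm q h1 h2
  exact hab ((hall a).trans (hall b).symm)

/-- Lebesgue measure on the unit interval -/
noncomputable abbrev mu01 : Measure ℝ := volume.restrict (Set.Icc (0:ℝ) 1)

lemma int01 (f : ℝ → ℝ) : ∫ t, f t ∂mu01 = ∫ t in (0:ℝ)..1, f t := by
  rw [intervalIntegral.integral_of_le zero_le_one, integral_Icc_eq_integral_Ioc]

lemma two_n_toReal (n : ℕ) : (2 * n : ℝ≥0∞).toReal = 2 * n := by simp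

lemma memU {p : ℝ≥0∞} {g : ℝ → ℝ} (hg : Measurable g) (C : ℝ) (hb : ∀ t, |g t| ≤ C) : MemLp g p mu01 :=
  MemLp.of_bound hg.aestronglyMeasurable C (Filter.Eventually.of_forall hb)

lemma norm_toLp_eq (n : ℕ) (hn : 2 ≤ n) (g : ℝ → ℝ) (hg : MemLp g (2 * n : ℝ≥0∞) mu01) :
    ‖hg.toLp g‖ = (∫ t, |g t| ^ (2 * n : ℝ) ∂mu01) ^ (1 / (2 * n : ℝ)) := by
  rw [Lp.norm_toLp, hg.eLpNorm_eq_integral_rpow_norm (by simp; omega)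
    (ENNReal.mul_ne_top (by simp) (by simp)), two_n_toReal, ENNReal.toReal_ofReal]
  · simp
  · exact Real.rpow_nonneg (integral_nonneg fun t => by positivity) _

abbrev E2 := EuclideanSpace ℝ (Fin 2)

/-- cosine of the angle function, as an element of Lp -/
noncomputable def cosL (p : ℝ≥0∞) (θ : ℝ → ℝ) (hθ : Measurable θ) : Lp ℝ p mu01 :=
  (memU (g := fun t => Real.cos (θ t)) (Real.measurable_cos.comp hθ) 1
    (fun _ => Real.abs_cos_le_one _)).toLp _

/-- sine of the angle function, as an element of Lp -/
noncomputable def sinL (p : ℝ≥0∞) (θ : ℝ → ℝ) (hθ : Measurable θ) : Lp ℝ p mu01 :=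
  (memU (g := fun t => Real.sin (θ t)) (Real.measurable_sin.comp hθ) 1
    (fun _ => Real.abs_sin_le_one _)).toLp _

lemma cosL_ae (p : ℝ≥0∞) (θ : ℝ → ℝ) (hθ : Measurable θ) :
    cosL p θ hθ =ᵐ[mu01] fun t => Real.cos (θ t) := MemLp.coeFn_toLp _

lemma sinL_ae (p : ℝ≥0∞) (θ : ℝ → ℝ) (hθ : Measurable θ) :
    sinL p θ hθ =ᵐ[mu01] fun t => Real.sin (θ t) := MemLp.coeFn_toLp _

/-- the map from the plane to Lp -/
noncomputable def Umap (p : ℝ≥0∞) (θ : ℝ → ℝ) (hθ : Measurable θ) : E2 →ₗ[ℝ] Lp ℝ p mu01 where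
  toFun x := x 0 • cosL p θ hθ + x 1 • sinL p θ hθ
  map_add' x y := by simp only [PiLp.add_apply, add_smul]; abel
  map_smul' c x := by simp only [PiLp.smul_apply, smul_eq_mul, mul_smul, smul_add, RingHom.id_apply]

lemma polar (a b : ℝ) : ∃ φ, a = Real.sqrt (a^2+b^2) * Real.cos φ ∧ b = Real.sqrt (a^2+b^2) * Real.sin φ := by
  refine ⟨(⟨a, b⟩ : ℂ).arg, ?_, ?_⟩
  · have := Complex.norm_mul_cos_arg ⟨a, b⟩
    rw [Complex.norm_eq_sqrt_sq_add_sq] at this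
    exact this.symm
  · have := Complex.norm_mul_sin_arg ⟨a, b⟩
    rw [Complex.norm_eq_sqrt_sq_add_sq] at this
    exact this.symm

lemma norm_Umap (n : ℕ) (hn : 2 ≤ n) [Fact (1 ≤ (2 * n : ℝ≥0∞))] (θ : ℝ → ℝ) (hθ : Measurable θ) (I : ℝ)
    (hI : ∀ φ, ∫ t, Real.cos (θ t - φ) ^ (2*n) ∂mu01 = I) (x : E2) :
    ‖Umap (2 * n) θ hθ x‖ = I ^ (1 / (2 * n : ℝ)) * ‖x‖ := by
  obtain ⟨φ, h0, h1⟩ := polar (x 0) (x 1)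
  have hx : ‖x‖ = Real.sqrt (x 0 ^ 2 + x 1 ^ 2) := by
    rw [EuclideanSpace.norm_eq]; simp
  rw [← hx] at h0 h1
  have hg : MemLp (fun t => Real.cos (θ t - φ)) (2 * n : ℝ≥0∞) mu01 :=
    memU (Real.measurable_cos.comp (hθ.sub_const φ)) 1 (fun _ => Real.abs_cos_le_one _)
  have e : Umap (2 * n) θ hθ x = ‖x‖ • hg.toLp _ := by
    apply Lp.ext
    have a1 := Lp.coeFn_add (x 0 • cosL (2*n) θ hθ) (x 1 • sinL (2*n) θ hθ)
    have a2 := Lp.coeFn_smul (x 0) (cosL (2*n) θ hθ)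
    have a3 := Lp.coeFn_smul (x 1) (sinL (2*n) θ hθ)
    have a4 := Lp.coeFn_smul ‖x‖ (hg.toLp _)
    filter_upwards [a1, a2, a3, a4, cosL_ae (2*n) θ hθ, sinL_ae (2*n) θ hθ, hg.coeFn_toLp]
      with t b1 b2 b3 b4 b5 b6 b7
    change (x 0 • cosL (2*n) θ hθ + x 1 • sinL (2*n) θ hθ : Lp ℝ (2*n) mu01) t = _
    rw [b1, b4, Pi.add_apply, b2, b3]
    simp only [Pi.smul_apply, smul_eq_mul, b5, b6, b7]
    rw [Real.cos_sub]
    linear_combination Real.cos (θ t) * h0 + Real.sin (θ t) * h1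
  rw [e, norm_smul, norm_toLp_eq n hn, norm_norm, mul_comm]
  congr 2
  rw [← hI φ]
  refine integral_congr_ae (Filter.Eventually.of_forall fun t => ?_)
  have : (2 * n : ℝ) = ((2 * n : ℕ) : ℝ) := by push_cast; ring
  simp only [this, Real.rpow_natCast]
  rw [pow_mul, sq_abs, ← pow_mul]

/-- the isometric embedding of the Euclidean plane -/
noncomputable def Jiso (n : ℕ) (hn : 2 ≤ n) [Fact (1 ≤ (2 * n : ℝ≥0∞))]
    (θ : ℝ → ℝ) (hθ : Measurable θ) (I : ℝ) (hI0 : 0 < I)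
    (hI : ∀ φ, ∫ t, Real.cos (θ t - φ) ^ (2*n) ∂mu01 = I) :
    E2 →ₗᵢ[ℝ] Lp ℝ (2 * n : ℝ≥0∞) mu01 where
  toLinearMap := (I ^ (1 / (2 * n : ℝ)))⁻¹ • Umap (2 * n) θ hθ
  norm_map' x := by
    have h0 : 0 < I ^ (1 / (2 * n : ℝ)) := by positivity
    rw [LinearMap.smul_apply, norm_smul, norm_Umap n hn θ hθ I hI, Real.norm_of_nonneg (by positivity)]
    field_simp

lemma Umap_eq_Jiso (n : ℕ) (hn : 2 ≤ n) [Fact (1 ≤ (2 * n : ℝ≥0∞))]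
    (θ : ℝ → ℝ) (hθ : Measurable θ) (I : ℝ) (hI0 : 0 < I)
    (hI : ∀ φ, ∫ t, Real.cos (θ t - φ) ^ (2*n) ∂mu01 = I) (x : E2) :
    Umap (2 * n) θ hθ x = Jiso n hn θ hθ I hI0 hI ((I ^ (1 / (2 * n : ℝ))) • x) := by
  have h0 : 0 < I ^ (1 / (2 * n : ℝ)) := by positivity
  rw [map_smul]
  change _ = _ • ((I ^ (1 / (2 * n : ℝ)))⁻¹ • Umap (2 * n) θ hθ x)
  rw [smul_smul, mul_inv_cancel₀ h0.ne', one_smul]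

lemma upper (n : ℕ) (hn : 2 ≤ n) [Fact (1 ≤ (2 * n : ℝ≥0∞))] (q : ℝ)
    (hpq : (2 * n : ℝ).HolderConjugate q)
    (θ : ℝ → ℝ) (hθ : Measurable θ) (I : ℝ) (hI0 : 0 < I)
    (hI : ∀ φ, ∫ t, Real.cos (θ t - φ) ^ (2*n) ∂mu01 = I) (M : ℝ)
    (hM : ∀ φ, ∫ t, |Real.cos (θ t - φ)| ^ q ∂mu01 = M)
    (hcc : ∫ t, Real.cos (θ t) * Real.cos (θ t) ∂mu01 = 1/2)
    (hcs : ∫ t, Real.cos (θ t) * Real.sin (θ t) ∂mu01 = 0)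
    (hss : ∫ t, Real.sin (θ t) * Real.sin (θ t) ∂mu01 = 1/2) :
    relProjConst (Jiso n hn θ hθ I hI0 hI).range ≤
      2 * I ^ (1 / (2 * n : ℝ)) * M ^ (1 / q) := by
  have h1p : (1 : ℝ≥0∞) ≤ 2 * n := Fact.out
  have hcm : Measurable fun t => Real.cos (θ t) := Real.measurable_cos.comp hθ
  have hsm : Measurable fun t => Real.sin (θ t) := Real.measurable_sin.comp hθ
  have hintg : ∀ f : Lp ℝ (2 * n : ℝ≥0∞) mu01, ∀ g : ℝ → ℝ, Measurable g → (∀ t, |g t| ≤ 1) →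
      Integrable (fun t => f t * g t) mu01 := fun f g hg hb =>
    ((Lp.memLp f).integrable h1p).mul_bdd hg.aestronglyMeasurable (Filter.Eventually.of_forall hb)
  have hfc := fun f => hintg f _ hcm (fun t => Real.abs_cos_le_one _)
  have hfs := fun f => hintg f _ hsm (fun t => Real.abs_sin_le_one _)
  -- the functional
  let Φ : (g : ℝ → ℝ) → (∀ f : Lp ℝ (2 * n : ℝ≥0∞) mu01, Integrable (fun t => f t * g t) mu01) →
      (Lp ℝ (2 * n : ℝ≥0∞) mu01 →ₗ[ℝ] ℝ) := fun g hg =>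
    { toFun := fun f => ∫ t, f t * g t ∂mu01
      map_add' := by
        intro f f'
        rw [← integral_add (hg f) (hg f')]
        refine integral_congr_ae ?_
        filter_upwards [Lp.coeFn_add f f'] with t ht
        rw [ht, Pi.add_apply, add_mul]
      map_smul' := by
        intro c f
        simp only [RingHom.id_apply, smul_eq_mul]
        rw [← integral_const_mul]
        refine integral_congr_ae ?_
        filter_upwards [Lp.coeFn_smul c f] with t ht
        rw [ht, Pi.smul_apply, smul_eq_mul, mul_assoc] }
  let α := Φ _ hfc
  let β := Φ _ hfs
  have hα : ∀ f, α f = ∫ t, f t * Real.cos (θ t) ∂mu01 := fun f => rfl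
  have hβ : ∀ f, β f = ∫ t, f t * Real.sin (θ t) ∂mu01 := fun f => rfl
  let W : Lp ℝ (2 * n : ℝ≥0∞) mu01 →ₗ[ℝ] E2 :=
    { toFun := fun f => !₂[2 * α f, 2 * β f]
      map_add' := by intro f g; ext i; fin_cases i <;> simp [mul_add]
      map_smul' := by intro c f; ext i; fin_cases i <;> simp <;> ring }
  have hq0 : 0 < q := hpq.symm.pos
  have hofp : ENNReal.ofReal (2 * n : ℝ) = (2 * n : ℝ≥0∞) := by
    rw [ENNReal.ofReal_mul (by norm_num)]; simp
  have hM0 : 0 ≤ M := by rw [← hM 0]; exact integral_nonneg fun t => by positivity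
  have hW : ∀ f, ‖W f‖ ≤ 2 * M ^ (1/q) * ‖f‖ := by
    intro f
    have hn1 : ‖W f‖ = 2 * Real.sqrt (α f ^ 2 + β f ^ 2) := by
      rw [EuclideanSpace.norm_eq]
      simp only [W, LinearMap.coe_mk, AddHom.coe_mk, Fin.sum_univ_two, Real.norm_eq_abs, sq_abs]
      simp only [Matrix.cons_val_zero, Matrix.cons_val_one]
      rw [show (2 * α f)^2 + (2 * β f)^2 = 2^2 * (α f ^2 + β f ^2) by ring,
        Real.sqrt_mul (by norm_num), Real.sqrt_sq (by norm_num)]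
    obtain ⟨φ, e0, e1⟩ := polar (α f) (β f)
    set r := Real.sqrt (α f ^ 2 + β f ^ 2) with hr
    have e2 : r = α f * Real.cos φ + β f * Real.sin φ := by
      linear_combination -Real.cos φ * e0 - Real.sin φ * e1 - r * Real.sin_sq_add_cos_sq φ
    have e3 : r = ∫ t, f t * Real.cos (θ t - φ) ∂mu01 := by
      rw [e2, hα, hβ, ← integral_mul_const, ← integral_mul_const,
        ← integral_add ((hfc f).mul_const _) ((hfs f).mul_const _)]
      refine integral_congr_ae (Filter.Eventually.of_forall fun t => ?_)
      simp only [Real.cos_sub]; ring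
    have hcmem : MemLp (fun t => Real.cos (θ t - φ)) (ENNReal.ofReal q) mu01 :=
      memU (Real.measurable_cos.comp (hθ.sub_const φ)) 1 (fun _ => Real.abs_cos_le_one _)
    have hfm : MemLp f (ENNReal.ofReal (2 * n : ℝ)) mu01 := by rw [hofp]; exact Lp.memLp f
    have hol := integral_mul_norm_le_Lp_mul_Lq hpq hfm hcmem
    have hfn : ‖f‖ = (∫ t, ‖f t‖ ^ (2 * n : ℝ) ∂mu01) ^ (1 / (2 * n : ℝ)) := by
      have := norm_toLp_eq n hn f (Lp.memLp f)
      rwa [Lp.toLp_coeFn] at this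
    have hMM : ∫ t, ‖Real.cos (θ t - φ)‖ ^ q ∂mu01 = M := hM φ
    rw [← hfn, hMM] at hol
    have : r ≤ ‖f‖ * M ^ (1/q) := by
      rw [e3]
      refine (le_abs_self _).trans ((abs_integral_le_integral_abs).trans ?_)
      refine le_trans (le_of_eq ?_) hol
      simp only [abs_mul, Real.norm_eq_abs]
    rw [hn1]; nlinarith
  set J := Jiso n hn θ hθ I hI0 hI with hJ
  set N := I ^ (1 / (2 * n : ℝ)) with hN
  have hNpos : 0 < N := by positivity
  let P : Lp ℝ (2 * n : ℝ≥0∞) mu01 →L[ℝ] Lp ℝ (2 * n : ℝ≥0∞) mu01 :=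
    LinearMap.mkContinuous ((Umap (2*n) θ hθ).comp W) (2 * N * M ^ (1/q)) (by
      intro f
      rw [LinearMap.comp_apply, norm_Umap n hn θ hθ I hI]
      have := mul_le_mul_of_nonneg_left (hW f) hNpos.le
      linarith)
  have hP : ∀ f, P f = Umap (2*n) θ hθ (W f) := fun f => rfl
  have hPn : ‖P‖ ≤ 2 * N * M ^ (1/q) := LinearMap.mkContinuous_norm_le _ (by positivity) _
  refine le_trans (csInf_le ⟨0, ?_⟩ ⟨P, ?_, ?_, rfl⟩) hPn
  · rintro c ⟨Q, -, -, rfl⟩; exact norm_nonneg _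
  · intro f
    rw [hP, Umap_eq_Jiso n hn θ hθ I hI0 hI]
    exact ⟨_, rfl⟩
  · have hα1 : α (cosL (2*n) θ hθ) = 1/2 := by
      rw [hα, ← hcc]; refine integral_congr_ae ?_
      filter_upwards [cosL_ae (2*n) θ hθ] with t ht; rw [ht]
    have hα2 : α (sinL (2*n) θ hθ) = 0 := by
      rw [hα, ← hcs]; refine integral_congr_ae ?_
      filter_upwards [sinL_ae (2*n) θ hθ] with t ht; rw [ht, mul_comm]
    have hβ1 : β (cosL (2*n) θ hθ) = 0 := by
      rw [hβ, ← hcs]; refine integral_congr_ae ?_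
      filter_upwards [cosL_ae (2*n) θ hθ] with t ht; rw [ht]
    have hβ2 : β (sinL (2*n) θ hθ) = 1/2 := by
      rw [hβ, ← hss]; refine integral_congr_ae ?_
      filter_upwards [sinL_ae (2*n) θ hθ] with t ht; rw [ht]
    have hWU : ∀ x, W (Umap (2*n) θ hθ x) = x := by
      intro x
      have hu : Umap (2*n) θ hθ x = x 0 • cosL (2*n) θ hθ + x 1 • sinL (2*n) θ hθ := rfl
      have ha : α (Umap (2*n) θ hθ x) = x 0 * (1/2) := by
        rw [hu, map_add, map_smul, map_smul, hα1, hα2]; simp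
      have hb : β (Umap (2*n) θ hθ x) = x 1 * (1/2) := by
        rw [hu, map_add, map_smul, map_smul, hβ1, hβ2]; simp
      change !₂[2 * α _, 2 * β _] = x
      rw [ha, hb]
      ext i; fin_cases i <;> simp <;> ring
    rintro y ⟨x, rfl⟩
    have : J x = Umap (2*n) θ hθ (N⁻¹ • x) := by
      rw [Umap_eq_Jiso n hn θ hθ I hI0 hI, smul_smul, mul_inv_cancel₀ hNpos.ne', one_smul]
    change P (J x) = J x
    rw [hP, this, hWU]

/-- the norming function -/
noncomputable def sfun (q : ℝ) (x : ℝ) : ℝ := Real.cos x * |Real.cos x| ^ (q - 2)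

lemma abs_sfun (q : ℝ) (hq : 1 < q) (x : ℝ) : |sfun q x| = |Real.cos x| ^ (q - 1) := by
  unfold sfun
  rw [abs_mul, abs_of_nonneg (by positivity : 0 ≤ |Real.cos x| ^ (q-2))]
  rcases (abs_nonneg (Real.cos x)).eq_or_lt with h | h
  · rw [← h, Real.zero_rpow (by linarith : q - 1 ≠ 0)]; simp
  · nth_rewrite 1 [← Real.rpow_one |Real.cos x|]
    rw [← Real.rpow_add h]; ring_nf

lemma sfun_mul_cos (q : ℝ) (hq : 1 < q) (x : ℝ) : sfun q x * Real.cos x = |Real.cos x| ^ q := by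
  unfold sfun
  have : Real.cos x * |Real.cos x| ^ (q - 2) * Real.cos x = |Real.cos x|^2 * |Real.cos x| ^ (q - 2) := by
    rw [sq_abs]; ring
  rw [this]
  rcases (abs_nonneg (Real.cos x)).eq_or_lt with h | h
  · rw [← h, Real.zero_rpow (by linarith : q ≠ 0)]; simp
  · rw [← Real.rpow_natCast, ← Real.rpow_add h]; norm_num

lemma sfun_meas (q : ℝ) : Measurable (sfun q) := by
  unfold sfun; fun_prop

lemma sfun_pi (q x : ℝ) : sfun q (x + Real.pi) = - sfun q x := by
  unfold sfun; simp [Real.cos_add_pi]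

lemma lower (n m : ℕ) (hn : 2 ≤ n) (hm : 0 < m) [Fact (1 ≤ (2 * n : ℝ≥0∞))] (q : ℝ)
    (hpq : (2 * n : ℝ).HolderConjugate q) (I : ℝ) (hI0 : 0 < I)
    (hI : ∀ φ, ∫ t, Real.cos (th m t - φ) ^ (2*n) ∂mu01 = I) (a : ℝ) :
      2 * I ^ (1 / (2 * n : ℝ)) * (GG m (fun x => |Real.cos x| ^ q) a / m) ^ (1 / q) ≤
    relProjConst (Jiso n hn (th m) (th_meas m) I hI0 hI).range := by
  set J := Jiso n hn (th m) (th_meas m) I hI0 hI with hJ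
  set N := I ^ (1 / (2 * n : ℝ)) with hN
  have hNpos : 0 < N := by positivity
  have hm' : (0:ℝ) < m := by positivity
  have hq1 : 1 < q := hpq.symm.lt
  refine le_csInf ?_ ?_
  · have : FiniteDimensional ℝ J.range := J.equivRange.toLinearEquiv.finiteDimensional
    obtain ⟨f, hf⟩ := Submodule.ClosedComplemented.of_finiteDimensional J.range
    refine ⟨_, J.range.subtypeL.comp f, fun x => (f x).2, fun y hy => ?_, rfl⟩
    have := hf ⟨y, hy⟩
    simp [this]
  rintro c ⟨P, hP1, hP2, rfl⟩
  set u0 := cosL (2*n) (th m) (th_meas m) with hu0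
  set u1 := sinL (2*n) (th m) (th_meas m) with hu1
  let V : Lp ℝ (2 * n : ℝ≥0∞) mu01 →ₗ[ℝ] E2 :=
    J.equivRange.symm.toLinearEquiv.toLinearMap.comp (P.toLinearMap.codRestrict J.range hP1)
  have hVn : ∀ f, ‖V f‖ ≤ ‖P‖ * ‖f‖ := by
    intro f
    have : ‖V f‖ = ‖P f‖ := by
      change ‖J.equivRange.symm _‖ = _
      rw [LinearIsometryEquiv.norm_map]; rfl
    rw [this]; exact P.le_opNorm f
  have hVU : ∀ x y : ℝ, V (x • u0 + y • u1) = N • !₂[x, y] := by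
    intro x y
    have h1 : x • u0 + y • u1 = J (N • !₂[x, y]) := by
      rw [hJ, ← Umap_eq_Jiso n hn (th m) (th_meas m) I hI0 hI]; rfl
    have h2 : P (J (N • !₂[x, y])) = J (N • !₂[x, y]) := hP2 _ ⟨_, rfl⟩
    change J.equivRange.symm _ = _
    rw [LinearIsometryEquiv.symm_apply_eq]
    apply Subtype.ext
    change P _ = J _
    rw [h1, h2]
  set G := GG m (fun x => |Real.cos x| ^ q) a with hG
  have hG0 : 0 ≤ G := Finset.sum_nonneg fun k _ => by positivity
  set D := Real.pi / m with hD
  -- test functions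
  have hmem : ∀ j : ℕ, MemLp (fun t => sfun q (th m t + a + j * D)) (2 * n : ℝ≥0∞) mu01 := fun j =>
    memU ((sfun_meas q).comp (((th_meas m).add_const a).add_const _)) 1 (fun t => by
      rw [abs_sfun q hq1]
      exact Real.rpow_le_one (abs_nonneg _) (Real.abs_cos_le_one _) (by linarith))
  let f : ℕ → Lp ℝ (2 * n : ℝ≥0∞) mu01 := fun j => (hmem j).toLp _
  have hfn : ∀ j, ‖f j‖ = (G / m) ^ (1 / (2 * n : ℝ)) := by
    intro j
    rw [norm_toLp_eq n hn]
    congr 1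
    have : ∀ t, |sfun q (th m t + a + j * D)| ^ (2 * n : ℝ) = |Real.cos ((a + j * D) + th m t)| ^ q := by
      intro t
      rw [abs_sfun q hq1, ← Real.rpow_mul (abs_nonneg _), hpq.symm.sub_one_mul_conj]
      congr 3; ring
    simp only [this]
    rw [int01, int_th m hm (fun x => |Real.cos x| ^ q)]
    congr 1
    have := GG_shift m hm _ (absq_periodic q) a j
    rw [hG, ← this]; simp [hD]
  set R := GG m (fun x => sfun q x * Real.sin x) a with hR
  have perR : Function.Periodic (fun x => sfun q x * Real.sin x) Real.pi := by
    intro x; simp [sfun_pi, Real.sin_add_pi]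
  -- angles: φ_j = -(a + j D)
  have hpt : ∀ t, (∑ j ∈ Finset.range m, sfun q (th m t + a + j * D) * Real.cos (th m t + a + j * D)) = G
      ∧ (∑ j ∈ Finset.range m, sfun q (th m t + a + j * D) * Real.sin (th m t + a + j * D)) = R := by
    intro t
    constructor
    · rw [hG, ← GG_shift m hm _ (absq_periodic q) a ⌊m * t⌋]
      unfold GG
      refine Finset.sum_congr rfl fun j _ => ?_
      rw [sfun_mul_cos q hq1]
      simp only [th]; congr 3; ring
    · rw [hR, ← GG_shift m hm _ perR a ⌊m * t⌋]
      unfold GG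
      refine Finset.sum_congr rfl fun j _ => ?_
      have : th m t + a + j * D = a + ⌊m * t⌋ * (Real.pi / m) + j * (Real.pi / m) := by
        simp only [th, hD]; ring
      rw [this]
  have hsumae : ∀ c : ℕ → ℝ, (∑ j ∈ Finset.range m, c j • f j : Lp ℝ (2 * n : ℝ≥0∞) mu01) =ᵐ[mu01]
      fun t => ∑ j ∈ Finset.range m, c j * sfun q (th m t + a + j * D) := by
    intro c
    have hk : ∀ s : Finset ℕ, (∑ j ∈ s, c j • f j : Lp ℝ (2 * n : ℝ≥0∞) mu01) =ᵐ[mu01]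
      fun t => ∑ j ∈ s, c j * sfun q (th m t + a + j * D) := by
      intro s
      induction s using Finset.induction_on with
      | empty =>
        simp only [Finset.sum_empty]
        exact Lp.coeFn_zero ℝ (2 * n : ℝ≥0∞) mu01
      | insert j s hj ih =>
        rw [Finset.sum_insert hj]
        filter_upwards [ih, Lp.coeFn_add (c j • f j) (∑ j ∈ s, c j • f j), Lp.coeFn_smul (c j) (f j),
          (hmem j).coeFn_toLp] with t h1 h2 h3 h4
        rw [h2, Pi.add_apply, h1, h3, Finset.sum_insert hj, Pi.smul_apply, smul_eq_mul]
        congr 2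
    exact hk _
  have hS0 : ∑ j ∈ Finset.range m, Real.cos (a + j * D) • f j = G • u0 + R • u1 := by
    apply Lp.ext
    filter_upwards [hsumae (fun j => Real.cos (a + j * D)), Lp.coeFn_add (G • u0) (R • u1),
      Lp.coeFn_smul G u0, Lp.coeFn_smul R u1, cosL_ae (2*n) (th m) (th_meas m),
      sinL_ae (2*n) (th m) (th_meas m)] with t h1 h2 h3 h4 h5 h6
    rw [h1, h2, Pi.add_apply, h3, h4, Pi.smul_apply, Pi.smul_apply, h5, h6, ← (hpt t).1, ← (hpt t).2]
    simp only [smul_eq_mul]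
    rw [Finset.sum_mul, Finset.sum_mul, ← Finset.sum_add_distrib]
    refine Finset.sum_congr rfl fun j _ => ?_
    have : Real.cos (a + j * D) = Real.cos ((th m t + a + j * D) - th m t) := by congr 1; ring
    rw [this, Real.cos_sub]; ring
  have hS1 : ∑ j ∈ Finset.range m, (-Real.sin (a + j * D)) • f j = (-R) • u0 + G • u1 := by
    apply Lp.ext
    filter_upwards [hsumae (fun j => -Real.sin (a + j * D)), Lp.coeFn_add ((-R) • u0) (G • u1),
      Lp.coeFn_smul (-R) u0, Lp.coeFn_smul G u1, cosL_ae (2*n) (th m) (th_meas m),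
      sinL_ae (2*n) (th m) (th_meas m)] with t h1 h2 h3 h4 h5 h6
    rw [h1, h2, Pi.add_apply, h3, h4, Pi.smul_apply, Pi.smul_apply, h5, h6, ← (hpt t).1, ← (hpt t).2]
    simp only [smul_eq_mul]
    rw [← Finset.sum_neg_distrib, Finset.sum_mul, Finset.sum_mul, ← Finset.sum_add_distrib]
    refine Finset.sum_congr rfl fun j _ => ?_
    have : Real.sin (a + j * D) = Real.sin ((th m t + a + j * D) - th m t) := by congr 1; ring
    rw [this, Real.sin_sub]; ring
  have hV0 := congrArg (fun g => (V g) 0) hS0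
  have hV1 := congrArg (fun g => (V g) 1) hS1
  simp only [hVU, map_sum, map_smul] at hV0 hV1
  simp at hV0 hV1
  have hbound : ∀ j : ℕ, Real.cos (a + j * D) * (V (f j)) 0 + (-(Real.sin (a + j * D) * (V (f j)) 1)) ≤
      ‖P‖ * (G / m) ^ (1 / (2 * n : ℝ)) := by
    intro j
    rw [← hfn j]
    refine le_trans ?_ (hVn (f j))
    rw [EuclideanSpace.norm_eq]
    apply Real.le_sqrt_of_sq_le
    simp only [Fin.sum_univ_two, Real.norm_eq_abs, sq_abs]
    nlinarith [Real.sin_sq_add_cos_sq (a + j * D),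
      sq_nonneg (Real.sin (a + j * D) * (V (f j)) 0 + Real.cos (a + j * D) * (V (f j)) 1)]
  have hsum := Finset.sum_le_sum fun j (_ : j ∈ Finset.range m) => hbound j
  rw [Finset.sum_add_distrib, Finset.sum_neg_distrib, hV0, hV1] at hsum
  rw [Finset.sum_const, Finset.card_range, nsmul_eq_mul] at hsum
  have hx0 : 0 ≤ G / m := by positivity
  have hGm : G = m * (G / m) := by field_simp
  set x := G / m with hx
  have hsum2 : 2 * N * x ≤ ‖P‖ * x ^ (1 / (2 * n : ℝ)) := by
    rw [hGm] at hsum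
    refine le_of_mul_le_mul_left ?_ hm'
    linarith
  rcases hx0.eq_or_lt with h | h
  · rw [← h, Real.zero_rpow (one_div_pos.2 hpq.symm.pos).ne', mul_zero]
    exact norm_nonneg _
  · have hxx : x = x ^ (1/q) * x ^ (1 / (2 * n : ℝ)) := by
      rw [← Real.rpow_add h]
      have := hpq.symm.inv_add_inv_eq_one
      rw [one_div, one_div, this, Real.rpow_one]
    have hxp : 0 < x ^ (1 / (2 * n : ℝ)) := Real.rpow_pos_of_pos h _
    refine le_of_mul_le_mul_right ?_ hxp
    rw [mul_assoc, ← hxx]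
    exact hsum2

/-- For `p = 2n ∈ {4, 6, 8, …}` there exist two 2-dimensional subspaces
`A`, `B` of `L_p[0,1]`, both isometric to 2-dimensional Euclidean space, with different
relative projection constants. -/
theorem stmt_10 (n : ℕ) (hn : 2 ≤ n) [Fact (1 ≤ (2 * n : ℝ≥0∞))] :
    ∃ A B : Submodule ℝ (Lp ℝ (2 * n : ℝ≥0∞) (volume.restrict (Set.Icc (0:ℝ) 1))),
      Nonempty (EuclideanSpace ℝ (Fin 2) ≃ₗᵢ[ℝ] A) ∧
      Nonempty (EuclideanSpace ℝ (Fin 2) ≃ₗᵢ[ℝ] B) ∧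
      relProjConst A ≠ relProjConst B := by
  have hn' : (2:ℝ) ≤ n := by exact_mod_cast hn
  obtain ⟨q, hq⟩ : ∃ q : ℝ, q = 2 * n / (2 * n - 1) := ⟨_, rfl⟩
  have hpq : (2 * n : ℝ).HolderConjugate q := by
    rw [hq]; exact Real.HolderConjugate.conjExponent (by linarith)
  have hq1 : 1 < q := hpq.symm.lt
  have hq2 : q < 2 := by
    rw [hq, div_lt_iff₀ (by linarith)]; linarith
  let m := n + 1
  have hm : 0 < m := Nat.succ_pos n
  have hm' : (0:ℝ) < m := by positivity
  let I : ℝ := (n+1) * ((2*n).choose n) / 4^n / m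
  have hI0 : 0 < I := by
    have : 0 < (2*n).choose n := Nat.choose_pos (by omega)
    positivity
  have hGI : ∀ a, GG m (fun x => Real.cos x ^ (2*n)) a / m = I := fun a => by
    rw [GG_cos_pow n a]
  have perC : Function.Periodic (fun x => Real.cos x ^ (2*n)) Real.pi := by
    intro x; simp [Real.cos_add_pi, pow_mul]
  have hIB : ∀ φ, ∫ t, Real.cos (th m t - φ) ^ (2*n) ∂mu01 = I := by
    intro φ
    rw [int01, ← hGI (-φ), ← int_th m hm (fun x => Real.cos x ^ (2*n)) (-φ)]
    simp only [neg_add_eq_sub]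
  have hIA0 : ∫ t in (0:ℝ)..1, Real.cos (Real.pi * t) ^ (2*n) = I := by
    have h1 := int_GG m (fun x => Real.cos x ^ (2*n)) perC (by fun_prop)
    have h2 : ∀ a, GG m (fun x => Real.cos x ^ (2*n)) a = I * m := fun a => by
      rw [← hGI a]; field_simp
    simp only [h2, intervalIntegral.integral_const, sub_zero, one_smul] at h1
    have : (m:ℝ) * (∫ t in (0:ℝ)..1, Real.cos (Real.pi * t) ^ (2*n)) = m * I := by linarith
    exact mul_left_cancel₀ hm'.ne' this
  have hIA : ∀ φ, ∫ t, Real.cos (Real.pi * t - φ) ^ (2*n) ∂mu01 = I := by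
    intro φ
    rw [int01, ← hIA0, ← per_int (fun x => Real.cos x ^ (2*n)) perC (-φ)]
    simp only [sub_eq_add_neg]
  have hMA : ∀ φ, ∫ t, |Real.cos (Real.pi * t - φ)| ^ q ∂mu01 =
      ∫ t in (0:ℝ)..1, |Real.cos (Real.pi * t)| ^ q := by
    intro φ
    rw [int01, ← per_int (fun x => |Real.cos x| ^ q) (absq_periodic q) (-φ)]
    simp only [sub_eq_add_neg]
  have hθ : Measurable fun t : ℝ => Real.pi * t := by fun_prop
  have hcc : ∫ t, Real.cos (Real.pi * t) * Real.cos (Real.pi * t) ∂mu01 = 1/2 := by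
    rw [int01, intervalIntegral.integral_comp_mul_left (fun x => Real.cos x * Real.cos x) Real.pi_ne_zero]
    simp only [← sq, integral_cos_sq]
    simp; field_simp
  have hss : ∫ t, Real.sin (Real.pi * t) * Real.sin (Real.pi * t) ∂mu01 = 1/2 := by
    rw [int01, intervalIntegral.integral_comp_mul_left (fun x => Real.sin x * Real.sin x) Real.pi_ne_zero]
    simp only [← sq, integral_sin_sq]
    simp; field_simp
  have hcs : ∫ t, Real.cos (Real.pi * t) * Real.sin (Real.pi * t) ∂mu01 = 0 := by
    rw [int01, intervalIntegral.integral_comp_mul_left (fun x => Real.cos x * Real.sin x) Real.pi_ne_zero]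
    simp only [mul_comm (Real.cos _), integral_sin_mul_cos₁]
    simp
  obtain ⟨a, ha⟩ := exists_gt m hm q hq1 hq2
  refine ⟨(Jiso n hn (fun t => Real.pi * t) hθ I hI0 hIA).range,
    (Jiso n hn (th m) (th_meas m) I hI0 hIB).range, ⟨LinearIsometry.equivRange _⟩,
    ⟨LinearIsometry.equivRange _⟩, ne_of_lt ?_⟩
  refine (upper n hn q hpq _ hθ I hI0 hIA _ hMA hcc hcs hss).trans_lt
    (lt_of_lt_of_le ?_ (lower n m hn hm q hpq I hI0 hIB a))
  have hN : 0 < I ^ (1 / (2 * n : ℝ)) := by positivity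
  have hM0 : 0 ≤ ∫ t in (0:ℝ)..1, |Real.cos (Real.pi * t)| ^ q := by
    rw [← hMA 0]; exact integral_nonneg fun t => by positivity
  exact mul_lt_mul_of_pos_left
    (Real.rpow_lt_rpow hM0 ha (one_div_pos.2 (by linarith))) (by positivity)
end

section
/- Let Z be a 2-dimensional Banach space such that the set of extreme points of its unit ball has linear (1-dimensional Hausdorff) measure zero in the boundary of the unit ball. Then Z* is isometrically isomorphic to a subspace of ℓ¹. -/
open MeasureTheory

namespace Zonoid

variable {Z : Type*} [NormedAddCommGroup Z] [NormedSpace ℝ Z]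

/-- The kernel of a nonzero functional on a plane is a line. -/
lemma ker_line (hdim : Module.finrank ℝ Z = 2) (f : Z →L[ℝ] ℝ) (hf : f ≠ 0) :
    ∃ w : Z, w ≠ 0 ∧ f w = 0 ∧ ∀ z, f z = 0 → ∃ s : ℝ, z = s • w := by
  have : FiniteDimensional ℝ Z := FiniteDimensional.of_finrank_pos (by omega)
  have hf' : (f : Z →ₗ[ℝ] ℝ) ≠ 0 := by
    intro h; apply hf; ext z; exact LinearMap.congr_fun h z
  have h1 := Module.Dual.finrank_ker_add_one_of_ne_zero hf'
  have h2 : Module.finrank ℝ (LinearMap.ker (f : Z →ₗ[ℝ] ℝ)) = 1 := by omega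
  obtain ⟨v, hv, hs⟩ := finrank_eq_one_iff'.1 h2
  refine ⟨v, by simpa using hv, v.2, fun z hz => ?_⟩
  obtain ⟨c, hc⟩ := hs ⟨z, hz⟩
  exact ⟨c, by simpa using (congrArg Subtype.val hc).symm⟩

lemma apply_le (g : Z →L[ℝ] ℝ) (hg : ‖g‖ ≤ 1) (z : Z) : g z ≤ ‖z‖ := by
  have h1 := g.le_opNorm z
  have h2 := le_abs_self (g z)
  rw [Real.norm_eq_abs] at h1
  nlinarith [norm_nonneg z]

lemma avg_min (s t p q a : ℝ) (hs : 0 < s) (ht : 0 < t) (hst : s + t = 1)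
    (e : s * p + t * q = a) (h1 : a ≤ p) (h2 : a ≤ q) : p = a ∧ q = a := by
  have e' : s * (p - a) + t * (q - a) = 0 := by
    have : s = 1 - t := by linarith
    subst this; linarith
  have h3 : 0 ≤ s * (p - a) := mul_nonneg hs.le (by linarith)
  have h4 : 0 ≤ t * (q - a) := mul_nonneg ht.le (by linarith)
  have h5 : s * (p - a) = 0 := by linarith
  have h6 : t * (q - a) = 0 := by linarith
  rcases mul_eq_zero.1 h5 with h | h <;> rcases mul_eq_zero.1 h6 with h' | h' <;>
    constructor <;> linarith

/-- functionals defining nondegenerate edges -/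
def G (Z : Type*) [NormedAddCommGroup Z] [NormedSpace ℝ Z] : Set (Z →L[ℝ] ℝ) :=
  {g | ‖g‖ ≤ 1 ∧ ∃ x y, x ≠ y ∧ g x = 1 ∧ g y = 1 ∧ ‖x‖ = 1 ∧ ‖y‖ = 1}

lemma endpoints (hdim : Module.finrank ℝ Z = 2) (g : Z →L[ℝ] ℝ) (hg : g ∈ G Z) :
    ∃ a b : Z, a ≠ b ∧ g a = 1 ∧ g b = 1 ∧ ‖a‖ = 1 ∧ ‖b‖ = 1 ∧
      ∀ z, g z = 1 → ‖z‖ = 1 → z ∉ Set.extremePoints ℝ (Metric.closedBall (0 : Z) 1) →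
        z ∈ openSegment ℝ a b := by
  have : FiniteDimensional ℝ Z := FiniteDimensional.of_finrank_pos (by omega)
  have : ProperSpace Z := FiniteDimensional.proper ℝ Z
  obtain ⟨hg1, x, y, hxy, hx, hy, nx, ny⟩ := hg
  have g0 : g ≠ 0 := by rintro rfl; simp at hx
  obtain ⟨w, hw, gw, hker⟩ := ker_line hdim g g0
  obtain ⟨h, -, hh⟩ := exists_dual_vector ℝ w (norm_ne_zero_iff.2 hw)
  have hh0 : h w ≠ 0 := by rw [hh]; simpa using hw
  have inj : ∀ z z', g z = g z' → h z = h z' → z = z' := by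
    intro z z' h1 h2
    obtain ⟨s, hs⟩ := hker (z - z') (by rw [map_sub, h1, sub_self])
    have h3 : s * h w = 0 := by
      have := congrArg h hs
      rw [map_sub, h2, sub_self, map_smul, smul_eq_mul] at this
      exact this.symm
    have : s = 0 := by simpa [hh0] using h3
    rw [this, zero_smul] at hs
    exact sub_eq_zero.1 hs
  set F : Set Z := Metric.closedBall 0 1 ∩ {z | g z = 1} with hF
  have hFc : IsCompact F := (isCompact_closedBall 0 1).inter_right
    (isClosed_eq g.continuous continuous_const)
  have memF : ∀ z, z ∈ F ↔ ‖z‖ = 1 ∧ g z = 1 := by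
    intro z
    simp only [hF, Set.mem_inter_iff, mem_closedBall_zero_iff, Set.mem_ofPred_eq]
    constructor
    · rintro ⟨h1, h2⟩
      exact ⟨le_antisymm h1 (by have := apply_le g hg1 z; linarith), h2⟩
    · rintro ⟨h1, h2⟩; exact ⟨h1.le, h2⟩
  have hxF : x ∈ F := (memF x).2 ⟨nx, hx⟩
  have hyF : y ∈ F := (memF y).2 ⟨ny, hy⟩
  obtain ⟨a, haF, ha⟩ := hFc.exists_isMinOn ⟨x, hxF⟩ h.continuous.continuousOn
  obtain ⟨b, hbF, hb⟩ := hFc.exists_isMaxOn ⟨x, hxF⟩ h.continuous.continuousOn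
  have ha' : ∀ z ∈ F, h a ≤ h z := fun z hz => ha hz
  have hb' : ∀ z ∈ F, h z ≤ h b := fun z hz => hb hz
  have ga := ((memF a).1 haF).2
  have gb := ((memF b).1 hbF).2
  have hlt : h a < h b := by
    by_contra hcon
    apply hxy
    apply inj _ _ (by rw [hx, hy])
    have := ha' x hxF; have := ha' y hyF; have := hb' x hxF; have := hb' y hyF
    linarith
  -- faces
  have face : ∀ z ∈ F, ∀ p ∈ Metric.closedBall (0:Z) 1, ∀ q ∈ Metric.closedBall (0:Z) 1,
      ∀ s t : ℝ, 0 < s → 0 < t → s + t = 1 → s • p + t • q = z → p ∈ F ∧ q ∈ F := by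
    intro z hz p hp q hq s t hs ht hst hpq
    have hp1 := apply_le g hg1 p
    have hq1 := apply_le g hg1 q
    have hp2 : ‖p‖ ≤ 1 := by simpa using hp
    have hq2 : ‖q‖ ≤ 1 := by simpa using hq
    have e : s * g p + t * g q = 1 := by
      have := congrArg g hpq
      rw [((memF z).1 hz).2] at this
      simpa using this
    have gp : g p = 1 := by nlinarith
    have gq : g q = 1 := by nlinarith
    exact ⟨⟨hp, gp⟩, ⟨hq, gq⟩⟩
  have exta : a ∈ Set.extremePoints ℝ (Metric.closedBall (0 : Z) 1) := by
    rw [mem_extremePoints]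
    refine ⟨haF.1, ?_⟩
    rintro p hp q hq ⟨s, t, hs, ht, hst, hpq⟩
    obtain ⟨hpF, hqF⟩ := face a haF p hp q hq s t hs ht hst hpq
    have e : s * h p + t * h q = h a := by simpa using congrArg h hpq
    have h1 := ha' p hpF
    have h2 := ha' q hqF
    obtain ⟨e1, e2⟩ := avg_min _ _ _ _ _ hs ht hst e h1 h2
    refine ⟨inj _ _ (by rw [ga, ((memF p).1 hpF).2]) (by linarith),
      inj _ _ (by rw [ga, ((memF q).1 hqF).2]) (by linarith)⟩
  have extb : b ∈ Set.extremePoints ℝ (Metric.closedBall (0 : Z) 1) := by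
    rw [mem_extremePoints]
    refine ⟨hbF.1, ?_⟩
    rintro p hp q hq ⟨s, t, hs, ht, hst, hpq⟩
    obtain ⟨hpF, hqF⟩ := face b hbF p hp q hq s t hs ht hst hpq
    have e : s * h p + t * h q = h b := by simpa using congrArg h hpq
    have h1 := hb' p hpF
    have h2 := hb' q hqF
    obtain ⟨e1, e2⟩ := avg_min s t (-h p) (-h q) (-h b) hs ht hst (by linarith) (by linarith)
      (by linarith)
    refine ⟨inj _ _ (by rw [gb, ((memF p).1 hpF).2]) (by linarith),
      inj _ _ (by rw [gb, ((memF q).1 hqF).2]) (by linarith)⟩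
  refine ⟨a, b, ?_, ga, gb, ((memF a).1 haF).1, ((memF b).1 hbF).1, ?_⟩
  · rintro rfl; exact lt_irrefl _ hlt
  intro z gz nz hz
  have hzF := (memF z).2 ⟨nz, gz⟩
  have ne1 : h a ≠ h z := by
    intro e; apply hz; rw [← inj a z (by rw [ga, gz]) e]; exact exta
  have ne2 : h z ≠ h b := by
    intro e; apply hz; rw [inj z b (by rw [gb, gz]) e]; exact extb
  have l1 := lt_of_le_of_ne (ha' z hzF) ne1
  have l2 := lt_of_le_of_ne (hb' z hzF) ne2
  have hd : 0 < h b - h a := by linarith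
  refine ⟨(h b - h z) / (h b - h a), (h z - h a) / (h b - h a), div_pos (by linarith) hd,
    div_pos (by linarith) hd, by field_simp; ring, ?_⟩
  apply inj
  · simp only [map_add, map_smul, smul_eq_mul, ga, gb, gz]; field_simp; ring
  · simp only [map_add, map_smul, smul_eq_mul]; field_simp; ring

lemma exists_G (z : Z) (hz : ‖z‖ = 1)
    (he : z ∉ Set.extremePoints ℝ (Metric.closedBall (0 : Z) 1)) : ∃ g ∈ G Z, g z = 1 := by
  have hz0 : z ≠ 0 := by rintro rfl; simp at hz
  obtain ⟨g, hg, hgz⟩ := exists_dual_vector ℝ z (norm_ne_zero_iff.2 hz0)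
  have hgz : g z = 1 := by rw [hgz, hz]; simp
  rw [mem_extremePoints_iff_left] at he
  push Not at he
  obtain ⟨p, hp, q, hq, ⟨s, t, hs, ht, hst, hpq⟩, hne⟩ := he (by simp [hz])
  have hp1 := apply_le g hg.le p
  have hq1 := apply_le g hg.le q
  have hp2 : ‖p‖ ≤ 1 := by simpa using hp
  have hq2 : ‖q‖ ≤ 1 := by simpa using hq
  have e : s * g p + t * g q = 1 := by
    have := congrArg g hpq
    rw [hgz] at this
    simpa using this
  have gp : g p = 1 := by nlinarith
  exact ⟨g, ⟨hg.le, p, z, hne, gp, hgz, by linarith, hz⟩, hgz⟩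

lemma unique_G (hdim : Module.finrank ℝ Z = 2) (g g' : Z →L[ℝ] ℝ) (hg' : ‖g'‖ ≤ 1)
    (a b z : Z) (hab : a ≠ b) (ga : g a = 1) (gb : g b = 1) (na : ‖a‖ = 1) (nb : ‖b‖ = 1)
    (hz : z ∈ openSegment ℝ a b) (gz : g' z = 1) : g' = g := by
  obtain ⟨s, t, hs, ht, hst, rfl⟩ := hz
  have h1 := apply_le g' hg' a
  have h2 := apply_le g' hg' b
  simp only [map_add, map_smul, smul_eq_mul] at gz
  have ga' : g' a = 1 := by nlinarith
  have gb' : g' b = 1 := by nlinarith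
  by_contra hne
  obtain ⟨w, hw, gw, hker⟩ := ker_line hdim (g' - g) (sub_ne_zero.2 hne)
  obtain ⟨u, hu⟩ := hker a (by simp [ga, ga'])
  obtain ⟨v, hv⟩ := hker b (by simp [gb, gb'])
  have e1 : u * g w = 1 := by rw [← ga, hu]; simp
  have e2 : v * g w = 1 := by rw [← gb, hv]; simp
  have : g w ≠ 0 := by intro h; simp [h] at e1
  have : u = v := mul_right_cancel₀ this (e1.trans e2.symm)
  exact hab (by rw [hu, hv, this])

lemma countable_G (hdim : Module.finrank ℝ Z = 2) : (G Z).Countable := by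
  have : FiniteDimensional ℝ Z := FiniteDimensional.of_finrank_pos (by omega)
  have : ProperSpace Z := FiniteDimensional.proper ℝ Z
  apply Set.PairwiseDisjoint.countable_of_isOpen
    (s := fun g : Z →L[ℝ] ℝ => interior {z | g z = ‖z‖})
  · intro g _ g' _ hne
    refine Set.disjoint_left.2 fun z hz hz' => hne ?_
    have h1 : ∀ᶠ x in nhds z, g x = ‖x‖ := mem_interior_iff_mem_nhds.1 hz
    have h2 : ∀ᶠ x in nhds z, g' x = ‖x‖ := mem_interior_iff_mem_nhds.1 hz'
    have h3 : (g : Z → ℝ) =ᶠ[nhds z] g' := by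
      filter_upwards [h1, h2] with x e1 e2
      rw [e1, e2]
    exact (g.hasFDerivAt (x := z)).unique ((g'.hasFDerivAt (x := z)).congr_of_eventuallyEq h3)
  · intro g _; exact isOpen_interior
  · rintro g ⟨hg, a, b, hab, ga, gb, na, nb⟩
    let L : ℝ × ℝ →ₗ[ℝ] Z :=
      (LinearMap.fst ℝ ℝ ℝ).smulRight a + (LinearMap.snd ℝ ℝ ℝ).smulRight b
    have hL : ∀ p, L p = p.1 • a + p.2 • b := fun p => rfl
    have inj : Function.Injective L := by
      rw [← LinearMap.ker_eq_bot, LinearMap.ker_eq_bot']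
      rintro ⟨s, t⟩ h
      rw [hL] at h
      simp only at h
      have e : s + t = 0 := by simpa [ga, gb] using congrArg g h
      have ht : t = -s := by linarith
      subst ht
      have : s • (a - b) = 0 := by rw [← h]; module
      rcases smul_eq_zero.1 this with h | h
      · simp [h]
      · exact absurd (sub_eq_zero.1 h) hab
    have surj : Function.Surjective L :=
      (LinearMap.injective_iff_surjective_of_finrank_eq_finrank (by simp [hdim])).1 inj
    have hop : IsOpenMap L := L.isOpenMap_of_finiteDimensional surj
    have ho : IsOpen (L '' (Set.Ioi 0 ×ˢ Set.Ioi 0)) := hop _ (isOpen_Ioi.prod isOpen_Ioi)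
    refine ⟨L (1, 1), ?_⟩
    refine interior_maximal ?_ ho ⟨(1, 1), by simp, rfl⟩
    rintro _ ⟨⟨s, t⟩, ⟨hs, ht⟩, rfl⟩
    simp only [Set.mem_Ioi] at hs ht
    rw [hL]
    simp only [Set.mem_ofPred_eq]
    refine le_antisymm (apply_le g hg _) ((norm_add_le _ _).trans ?_)
    rw [norm_smul, norm_smul, na, nb, Real.norm_of_nonneg hs.le, Real.norm_of_nonneg ht.le]
    simp [ga, gb]

lemma ray_unique (z w : Z) (hz : ‖z‖ < 1) (s s' : ℝ) (hs : 0 < s) (hss : s < s')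
    (h : ‖z + s • w‖ = 1) (h' : ‖z + s' • w‖ = 1) : False := by
  have hs' : 0 < s' := hs.trans hss
  have e : z + s • w = (1 - s / s') • z + (s / s') • (z + s' • w) := by
    rw [smul_add, smul_smul, div_mul_cancel₀ _ hs'.ne']; module
  have h1 : s / s' < 1 := (div_lt_one hs').2 hss
  have h2 : 0 < s / s' := div_pos hs hs'
  have h3 := norm_add_le ((1 - s / s') • z) ((s / s') • (z + s' • w))
  rw [← e, h, norm_smul, norm_smul, h', Real.norm_of_nonneg (by linarith),
    Real.norm_of_nonneg h2.le] at h3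
  nlinarith

lemma ray_unique' (z w : Z) (hz : ‖z‖ < 1) (s s' : ℝ) (hs : 0 < s) (hs' : 0 < s')
    (h : ‖z + s • w‖ = 1) (h' : ‖z + s' • w‖ = 1) : s = s' := by
  rcases lt_trichotomy s s' with h1 | h1 | h1
  · exact (ray_unique z w hz s s' hs h1 h h').elim
  · exact h1
  · exact (ray_unique z w hz s' s hs' h1 h' h).elim

lemma ray_exists (z w : Z) (hz : ‖z‖ < 1) (hw : w ≠ 0) : ∃ s : ℝ, 0 < s ∧ ‖z + s • w‖ = 1 := by
  have hw' : 0 < ‖w‖ := norm_pos_iff.2 hw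
  have hc : ContinuousOn (fun s : ℝ => ‖z + s • w‖) (Set.Icc 0 (2 / ‖w‖)) := by fun_prop
  have h2 : 1 ≤ ‖z + (2 / ‖w‖) • w‖ := by
    have h3 := norm_sub_norm_le ((2 / ‖w‖) • w) (-z)
    rw [norm_neg, norm_smul, Real.norm_of_nonneg (by positivity), div_mul_cancel₀ _ hw'.ne',
      sub_neg_eq_add, add_comm _ z] at h3
    linarith
  obtain ⟨s, hs, hs1⟩ := intermediate_value_Icc (by positivity) hc
    (show (1:ℝ) ∈ Set.Icc _ _ from ⟨by simpa using hz.le, h2⟩)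
  refine ⟨s, lt_of_le_of_ne hs.1 ?_, hs1⟩
  rintro rfl
  simp at hs1; linarith

lemma two_points (hdim : Module.finrank ℝ Z = 2) (f : Z →L[ℝ] ℝ) (t : ℝ) (ht : |t| < ‖f‖) :
    ∃ p q : Z, f p = t ∧ f q = t ∧ ‖p‖ = 1 ∧ ‖q‖ = 1 ∧
      (∃ z ∈ openSegment ℝ p q, ‖z‖ < 1) ∧ ∀ z, f z = t → ‖z‖ = 1 → z = p ∨ z = q := by
  have hf : f ≠ 0 := by
    rintro rfl; rw [norm_zero] at ht; exact absurd (abs_nonneg t) (not_le.2 ht)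
  obtain ⟨w, hw, fw, hker⟩ := ker_line hdim f hf
  obtain ⟨x, hx, hfx⟩ := f.exists_lt_apply_of_lt_opNorm ht
  rw [Real.norm_eq_abs] at hfx
  have hfx0 : 0 < |f x| := (abs_nonneg t).trans_lt hfx
  have hfx1 : f x ≠ 0 := abs_pos.1 hfx0
  obtain ⟨z, hz, fz⟩ : ∃ z : Z, ‖z‖ < 1 ∧ f z = t := by
    refine ⟨(t / f x) • x, ?_, by simp [hfx1]⟩
    rw [norm_smul, Real.norm_eq_abs, abs_div]
    have : |t| / |f x| < 1 := (div_lt_one hfx0).2 hfx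
    have h0 : 0 ≤ |t| / |f x| := by positivity
    nlinarith [norm_nonneg x]
  obtain ⟨s, hs, hs1⟩ := ray_exists z w hz hw
  obtain ⟨r, hr, hr1⟩ := ray_exists z (-w) hz (neg_ne_zero.2 hw)
  refine ⟨z + s • w, z + r • (-w), by simp [fz, fw], by simp [fz, fw], hs1, hr1,
    ⟨z, ⟨r / (s + r), s / (s + r), by positivity, by positivity, by field_simp; ring, ?_⟩, hz⟩, ?_⟩
  · have h1 : r / (s + r) + s / (s + r) = 1 := by field_simp; ring
    have h2 : r / (s + r) * s = s / (s + r) * r := by ring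
    calc _ = (r / (s + r) + s / (s + r)) • z + (r / (s + r) * s - s / (s + r) * r) • w := by module
      _ = z := by rw [h1, h2]; simp
  · intro y hy ny
    obtain ⟨c, hc⟩ := hker (y - z) (by simp [hy, fz])
    have hy' : y = z + c • w := by rw [← hc]; abel
    rcases lt_trichotomy c 0 with h | h | h
    · right
      have : y = z + (-c) • (-w) := by rw [hy']; simp
      rw [this] at ny
      rw [this, ray_unique' z (-w) hz (-c) r (by linarith) hr ny hr1]
    · rw [h] at hy'; simp at hy'; rw [hy'] at ny; linarith
    · left
      rw [hy'] at ny
      rw [hy', ray_unique' z w hz c s h hs ny hs1]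

lemma openSegment_volume (x y : ℝ) :
    MeasurableSet (openSegment ℝ x y) ∧ volume (openSegment ℝ x y) = ENNReal.ofReal |y - x| := by
  rcases lt_trichotomy x y with h | h | h
  · rw [openSegment_eq_Ioo h, Real.volume_Ioo, abs_of_pos (by linarith)]
    exact ⟨measurableSet_Ioo, rfl⟩
  · subst h; simp
  · rw [openSegment_symm, openSegment_eq_Ioo h, Real.volume_Ioo, abs_of_neg (by linarith)]
    exact ⟨measurableSet_Ioo, by simp⟩

lemma crofton [MeasurableSpace Z] [BorelSpace Z] (hdim : Module.finrank ℝ Z = 2)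
    (hext : μH[1] (Set.extremePoints ℝ (Metric.closedBall (0 : Z) 1)) = 0)
    (a b : G Z → Z) (hab : ∀ g, a g ≠ b g ∧ g.1 (a g) = 1 ∧ g.1 (b g) = 1 ∧ ‖a g‖ = 1 ∧ ‖b g‖ = 1 ∧
      ∀ z, g.1 z = 1 → ‖z‖ = 1 → z ∉ Set.extremePoints ℝ (Metric.closedBall (0 : Z) 1) →
        z ∈ openSegment ℝ (a g) (b g)) (f : Z →L[ℝ] ℝ) :
    ∑' g, ENNReal.ofReal |f (b g) - f (a g)| = ENNReal.ofReal (4 * ‖f‖) := by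
  classical
  have : Countable (G Z) := (countable_G hdim).to_subtype
  -- points of open edges
  have edge : ∀ g : G Z, ∀ z ∈ openSegment ℝ (a g) (b g), g.1 z = 1 ∧ ‖z‖ = 1 := by
    rintro g z ⟨s, t, hs, ht, hst, rfl⟩
    obtain ⟨-, ga, gb, na, nb, -⟩ := hab g
    have e : g.1 (s • a g + t • b g) = 1 := by simp [ga, gb, hst]
    refine ⟨e, le_antisymm ?_ ?_⟩
    · refine (norm_add_le _ _).trans ?_
      rw [norm_smul, norm_smul, na, nb, Real.norm_of_nonneg hs.le, Real.norm_of_nonneg ht.le]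
      linarith
    · have := apply_le g.1 g.2.1 (s • a g + t • b g); linarith
  have him : ∀ g, f '' openSegment ℝ (a g) (b g) = openSegment ℝ (f (a g)) (f (b g)) := fun g =>
    image_openSegment ℝ (f : Z →ₗ[ℝ] ℝ).toAffineMap (a g) (b g)
  have hnull : volume (f '' Set.extremePoints ℝ (Metric.closedBall (0 : Z) 1)) = 0 := by
    rw [← hausdorffMeasure_real]
    have := f.lipschitz.hausdorffMeasure_image_le (d := 1) zero_le_one
      (Set.extremePoints ℝ (Metric.closedBall (0 : Z) 1))
    rw [hext, mul_zero] at this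
    exact le_antisymm this bot_le
  let I : G Z → Set ℝ := fun g => openSegment ℝ (f (a g)) (f (b g))
  have key : ∀ᵐ t : ℝ, ∑' g, (I g).indicator (fun _ => (1 : ENNReal)) t
      = (Set.Ioo (-‖f‖) ‖f‖).indicator (fun _ => (2 : ENNReal)) t := by
    have n1 : ∀ᵐ t : ℝ, t ∉ f '' Set.extremePoints ℝ (Metric.closedBall (0 : Z) 1) :=
      measure_eq_zero_iff_ae_notMem.1 hnull
    have n2 : ∀ᵐ t : ℝ, t ∉ ({‖f‖} : Set ℝ) := measure_eq_zero_iff_ae_notMem.1 (by simp)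
    have n3 : ∀ᵐ t : ℝ, t ∉ ({-‖f‖} : Set ℝ) := measure_eq_zero_iff_ae_notMem.1 (by simp)
    filter_upwards [n1, n2, n3] with t h1 h2 h3
    simp only [Set.mem_singleton_iff] at h2 h3
    by_cases ht : t ∈ Set.Ioo (-‖f‖) ‖f‖
    · rw [Set.indicator_of_mem ht]
      obtain ⟨p, q, fp, fq, np, nq, ⟨z, hz, nz⟩, huniq⟩ := two_points hdim f t (abs_lt.2 ht)
      have hp : p ∉ Set.extremePoints ℝ (Metric.closedBall (0 : Z) 1) :=
        fun h => h1 ⟨p, h, fp⟩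
      have hq : q ∉ Set.extremePoints ℝ (Metric.closedBall (0 : Z) 1) :=
        fun h => h1 ⟨q, h, fq⟩
      obtain ⟨g, hg, gp⟩ := exists_G p np hp
      obtain ⟨k, hk, kq⟩ := exists_G q nq hq
      have hne : (⟨g, hg⟩ : G Z) ≠ ⟨k, hk⟩ := by
        intro e
        have e : g = k := congrArg Subtype.val e
        subst e
        obtain ⟨s, r, hs, hr, hsr, rfl⟩ := hz
        have := apply_le g hg.1 (s • p + r • q)
        simp only [map_add, map_smul, smul_eq_mul, gp, kq] at this
        linarith
      rw [tsum_eq_sum (s := {⟨g, hg⟩, ⟨k, hk⟩}), Finset.sum_pair hne,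
        Set.indicator_of_mem, Set.indicator_of_mem, one_add_one_eq_two]
      · change t ∈ openSegment ℝ _ _
        rw [← him]
        exact ⟨q, (hab ⟨k, hk⟩).2.2.2.2.2 q kq nq hq, fq⟩
      · change t ∈ openSegment ℝ _ _
        rw [← him]
        exact ⟨p, (hab ⟨g, hg⟩).2.2.2.2.2 p gp np hp, fp⟩
      · intro m hm
        apply Set.indicator_of_notMem
        intro hmt
        apply hm
        change t ∈ openSegment ℝ _ _ at hmt
        rw [← him] at hmt
        obtain ⟨y, hy, fy⟩ := hmt
        obtain ⟨mab, ma, mb, na, nb, -⟩ := hab m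
        obtain ⟨my, ny⟩ := edge m y hy
        rw [Finset.mem_insert, Finset.mem_singleton]
        rcases huniq y fy ny with rfl | rfl
        · left
          exact Subtype.ext (unique_G hdim m.1 g hg.1 _ _ _ mab ma mb na nb hy gp).symm
        · right
          exact Subtype.ext (unique_G hdim m.1 k hk.1 _ _ _ mab ma mb na nb hy kq).symm
    · rw [Set.indicator_of_notMem ht, ENNReal.tsum_eq_zero]
      intro m
      apply Set.indicator_of_notMem
      intro hmt
      change t ∈ openSegment ℝ _ _ at hmt
      rw [← him] at hmt
      obtain ⟨y, hy, fy⟩ := hmt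
      obtain ⟨my, ny⟩ := edge m y hy
      have h5 := f.le_opNorm y
      rw [ny, mul_one, fy, Real.norm_eq_abs, abs_le] at h5
      exact ht ⟨lt_of_le_of_ne h5.1 (Ne.symm h3), lt_of_le_of_ne h5.2 h2⟩
  have hint := lintegral_congr_ae key
  rw [lintegral_tsum (fun g => (measurable_const.indicator
    (openSegment_volume _ _).1).aemeasurable), lintegral_indicator_const measurableSet_Ioo,
    Real.volume_Ioo] at hint
  have e1 : ∀ g, ∫⁻ t, (I g).indicator (fun _ => (1 : ENNReal)) t
      = ENNReal.ofReal |f (b g) - f (a g)| := by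
    intro g
    rw [lintegral_indicator_const (openSegment_volume _ _).1, one_mul]
    exact (openSegment_volume _ _).2
  rw [tsum_congr e1] at hint
  rw [hint, show (2 : ENNReal) = ENNReal.ofReal 2 by simp, ← ENNReal.ofReal_mul (by norm_num)]
  congr 1; ring

end Zonoid

/-- If `Z` is a 2-dimensional Banach space such that the set of extreme points
of its unit ball has linear (1-dimensional Hausdorff) measure zero, then the dual `Z*` embeds
isometrically into `ℓ¹`. -/
theorem stmt_13 {Z : Type*} [NormedAddCommGroup Z] [NormedSpace ℝ Z]
    [MeasurableSpace Z] [BorelSpace Z]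
    (hdim : Module.finrank ℝ Z = 2)
    (hext : μH[1] (Set.extremePoints ℝ (Metric.closedBall (0 : Z) 1)) = 0) :
    Nonempty ((Z →L[ℝ] ℝ) →ₗᵢ[ℝ] lp (fun _ : ℕ => ℝ) 1) := by
  classical
  have H := fun g : Zonoid.G Z => Zonoid.endpoints hdim g.1 g.2
  choose a b hab using H
  have hcro := Zonoid.crofton hdim hext a b hab
  have : Countable (Zonoid.G Z) := (Zonoid.countable_G hdim).to_subtype
  obtain ⟨i, hi⟩ := exists_injective_nat (Zonoid.G Z)
  let v : ℕ → Z := Function.extend i (fun g => (1 / 4 : ℝ) • (b g - a g)) 0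
  have hv : ∀ g, v (i g) = (1 / 4 : ℝ) • (b g - a g) := fun g => hi.extend_apply _ _ g
  have hv0 : ∀ n, n ∉ Set.range i → v n = 0 := fun n hn =>
    Function.extend_apply' _ _ _ (by simpa using hn)
  have hsum : ∀ f : Z →L[ℝ] ℝ, ∑' n, ENNReal.ofReal ‖f (v n)‖ = ENNReal.ofReal ‖f‖ := by
    intro f
    have h1 : ∑' g, ENNReal.ofReal ‖f (v (i g))‖ = ∑' n, ENNReal.ofReal ‖f (v n)‖ := by
      apply hi.tsum_eq (f := fun n => ENNReal.ofReal ‖f (v n)‖)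
      intro n hn
      by_contra h
      exact hn (by simp [hv0 n h])
    rw [← h1]
    have h2 : ∀ g, ENNReal.ofReal ‖f (v (i g))‖
        = ENNReal.ofReal (1 / 4) * ENNReal.ofReal |f (b g) - f (a g)| := by
      intro g
      rw [hv, ← ENNReal.ofReal_mul (by norm_num), map_smul, map_sub, norm_smul,
        Real.norm_of_nonneg (by norm_num), Real.norm_eq_abs]
    simp_rw [h2]
    rw [ENNReal.tsum_mul_left, hcro, ← ENNReal.ofReal_mul (by norm_num)]
    congr 1; ring
  have hhas : ∀ f : Z →L[ℝ] ℝ, HasSum (fun n => ‖f (v n)‖) ‖f‖ := by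
    intro f
    have hs : Summable (fun n => ‖f (v n)‖) := by
      have : ∑' n, ENNReal.ofReal ‖f (v n)‖ ≠ ⊤ := by rw [hsum]; exact ENNReal.ofReal_ne_top
      have := ENNReal.summable_toReal this
      simpa using this
    have h2 := ENNReal.ofReal_tsum_of_nonneg (fun n => norm_nonneg (f (v n))) hs
    rw [hsum, ENNReal.ofReal_eq_ofReal_iff (tsum_nonneg fun n => norm_nonneg _)
      (norm_nonneg _)] at h2
    rw [← h2]; exact hs.hasSum
  have hmem : ∀ f : Z →L[ℝ] ℝ, Memℓp (fun n => f (v n)) 1 := by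
    intro f
    rw [memℓp_gen_iff (by simp)]
    simpa using (hhas f).summable
  refine ⟨⟨⟨⟨fun f => ⟨fun n => f (v n), hmem f⟩, ?_⟩, ?_⟩, ?_⟩⟩
  · intro f f'; ext n; rfl
  · intro c f; ext n; rfl
  · intro f
    rw [lp.norm_eq_tsum_rpow (by simp)]
    simpa using (hhas f).tsum_eq
end

section
/- Let Z be a 2-dimensional Banach space whose dual Z* is isometrically isomorphic to a subspace of ℓ¹. Then the set of extreme points of the unit ball of Z has linear measure zero on the boundary of the unit ball. -/
open MeasureTheory

namespace Stmt14

lemma step_null (A : Set ℝ) (u : ℝ → ℝ) (hu : Monotone u) (P : ℝ → Prop)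
    (hP : ∀ s t, s ≤ t → P s → P t) (a b : ℝ) (v : ℝ → ℝ)
    (hv1 : ∀ t, P t → v t = u t + a) (hv2 : ∀ t, ¬ P t → v t = u t + b) :
    volume (v '' A) ≤ volume (u '' A) := by
  classical
  set A1 := A ∩ {t | P t}
  set A2 := A ∩ {t | ¬ P t}
  have hle : volume (v '' A) ≤ volume (u '' A1) + volume (u '' A2) := by
    have hsub : v '' A ⊆ ((fun x => x + a) '' (u '' A1)) ∪ ((fun x => x + b) '' (u '' A2)) := by
      rintro _ ⟨t, ht, rfl⟩
      by_cases h : P t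
      · left; exact ⟨u t, ⟨t, ⟨ht, h⟩, rfl⟩, (hv1 t h).symm⟩
      · right; exact ⟨u t, ⟨t, ⟨ht, h⟩, rfl⟩, (hv2 t h).symm⟩
    refine (measure_mono hsub).trans ((measure_union_le _ _).trans ?_)
    rw [Set.image_add_right, Set.image_add_right, measure_preimage_add_right,
      measure_preimage_add_right]
  refine hle.trans ?_
  by_cases h2 : A2.Nonempty
  swap
  · rw [Set.not_nonempty_iff_eq_empty] at h2
    rw [h2]; simp only [Set.image_empty, measure_empty, add_zero]
    exact measure_mono (Set.image_mono Set.inter_subset_left)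
  by_cases h1 : A1.Nonempty
  swap
  · rw [Set.not_nonempty_iff_eq_empty] at h1
    rw [h1]; simp only [Set.image_empty, measure_empty, zero_add]
    exact measure_mono (Set.image_mono Set.inter_subset_left)
  have hsep : ∀ x ∈ u '' A2, ∀ y ∈ u '' A1, x ≤ y := by
    rintro _ ⟨s, hs, rfl⟩ _ ⟨t, ht, rfl⟩
    apply hu
    by_contra hlt
    exact hs.2 (hP t s (le_of_lt (not_le.mp hlt)) ht.2)
  obtain ⟨y0, hy0⟩ := h1.image u
  set p := sSup (u '' A2)
  have hbdd : BddAbove (u '' A2) := ⟨y0, fun x hx => hsep x hx y0 hy0⟩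
  have hp2 : ∀ x ∈ u '' A2, x ≤ p := fun x hx => le_csSup hbdd hx
  have hp1 : ∀ y ∈ u '' A1, p ≤ y := fun y hy => csSup_le (h2.image u) fun x hx => hsep x hx y hy
  rw [← measure_inter_add_sdiff (u '' A) (measurableSet_Iic (a := p)), add_comm]
  have e2 : u '' A2 ⊆ u '' A ∩ Set.Iic p := fun x hx =>
    ⟨Set.image_mono Set.inter_subset_left hx, hp2 x hx⟩
  have e1 : u '' A1 ⊆ (u '' A \ Set.Iic p) ∪ {p} := by
    intro y hy
    rcases (hp1 y hy).eq_or_lt with h | h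
    · right; exact h.symm
    · left; exact ⟨Set.image_mono Set.inter_subset_left hy, not_le.mpr h⟩
  refine add_le_add (measure_mono e2) ((measure_mono e1).trans ((measure_union_le _ _).trans ?_))
  simp

/-- the range of a pure jump monotone function is null -/
lemma jump_null (c : ℕ → ℝ) (hc : ∀ n, 0 ≤ c n) (hs : Summable c) (P : ℕ → ℝ → Prop)
    (hP : ∀ n s t, s ≤ t → P n s → P n t) (σ : ℕ → ℝ → ℝ)
    (h1 : ∀ n t, P n t → σ n t = 1) (h2 : ∀ n t, ¬ P n t → σ n t = -1) :
    volume (Set.range fun t => ∑' n, σ n t * c n) = 0 := by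
  have habs : ∀ n t, |σ n t| ≤ 1 := by
    intro n t
    by_cases h : P n t
    · simp [h1 n t h]
    · simp [h2 n t h]
  have hmono : ∀ n, Monotone (σ n) := by
    intro n s t hst
    by_cases h : P n s
    · rw [h1 n s h, h1 n t (hP n s t hst h)]
    · rw [h2 n s h]; exact (abs_le.mp (habs n t)).1
  have hb : ∀ n t, ‖σ n t * c n‖ ≤ c n := by
    intro n t
    rw [norm_mul, Real.norm_eq_abs, Real.norm_of_nonneg (hc n)]
    exact mul_le_of_le_one_left (hc n) (habs n t)
  have hsum : ∀ t, Summable fun n => σ n t * c n := fun t =>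
    Summable.of_norm_bounded hs (fun n => hb n t)
  let m : ℕ → ℝ → ℝ := fun N t => ∑' n, σ (n + N) t * c (n + N)
  have hsumN : ∀ N t, Summable fun n => σ (n + N) t * c (n + N) := fun N t =>
    (summable_nat_add_iff (f := fun n => σ n t * c n) N).mpr (hsum t)
  have hm : ∀ N, Monotone (m N) := by
    intro N s t hst
    exact (hsumN N s).tsum_le_tsum
      (fun n => mul_le_mul_of_nonneg_right (hmono _ hst) (hc _)) (hsumN N t)
  have hsucc : ∀ N t, m N t = m (N + 1) t + σ N t * c N := by
    intro N t
    have := (hsumN N t).tsum_eq_zero_add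
    simp only [m]
    rw [this, zero_add, add_comm]
    congr 2
    ext n
    rw [show n + 1 + N = n + (N + 1) by ring]
  have hstep : ∀ N, volume (Set.range (m 0)) ≤ volume (Set.range (m N)) := by
    intro N
    induction N with
    | zero => exact le_rfl
    | succ N ih =>
      refine ih.trans ?_
      rw [← Set.image_univ, ← Set.image_univ]
      refine step_null Set.univ (m (N + 1)) (hm _) (P N) (hP N) (c N) (- c N) (m N) ?_ ?_
      · intro t ht; rw [hsucc, h1 N t ht, one_mul]
      · intro t ht; rw [hsucc, h2 N t ht]; ring
  let r : ℕ → ℝ := fun N => ∑' n, c (n + N)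
  have hr : Filter.Tendsto r Filter.atTop (nhds 0) := tendsto_sum_nat_add c
  have hbound : ∀ N, volume (Set.range (m N)) ≤ ENNReal.ofReal (2 * r N) := by
    intro N
    have : Set.range (m N) ⊆ Set.Icc (- r N) (r N) := by
      rintro _ ⟨t, rfl⟩
      have : ‖m N t‖ ≤ r N := by
        exact tsum_of_norm_bounded ((summable_nat_add_iff N).mpr hs).hasSum (fun n => hb _ t)
      exact abs_le.mp this
    refine (measure_mono this).trans ?_
    rw [Real.volume_Icc]
    apply le_of_eq; congr 1; ring
  have hlim : Filter.Tendsto (fun N => ENNReal.ofReal (2 * r N)) Filter.atTop (nhds 0) := by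
    have := ENNReal.tendsto_ofReal (hr.const_mul 2)
    simpa using this
  have h0 : volume (Set.range (m 0)) ≤ 0 :=
    ge_of_tendsto' hlim fun N => (hstep N).trans (hbound N)
  simpa [m] using h0

section
variable {Z : Type*} [NormedAddCommGroup Z] [NormedSpace ℝ Z]

lemma range_null [MeasurableSpace Z] [BorelSpace Z] (F : ℝ → Z) (m : ℝ → ℝ)
    (hm : volume (Set.range m) = 0) (h : ∀ s t, dist (F s) (F t) ≤ dist (m s) (m t)) :
    μH[1] (Set.range F) = 0 := by
  classical
  let L : ℝ → Z := fun y => F (Function.invFun m y)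
  have hL : ∀ t, L (m t) = F t := by
    intro t
    have h1 := h (Function.invFun m (m t)) t
    rw [Function.invFun_eq (f := m) ⟨t, rfl⟩, dist_self] at h1
    exact dist_le_zero.mp h1
  have hLip : LipschitzOnWith 1 L (Set.range m) := by
    refine LipschitzOnWith.of_dist_le_mul ?_
    rintro _ ⟨s, rfl⟩ _ ⟨t, rfl⟩
    rw [hL, hL]; simpa using h s t
  have himg : Set.range F = L '' Set.range m := by
    rw [← Set.range_comp]; congr 1; ext t; exact (hL t).symm
  rw [himg]
  have := hLip.hausdorffMeasure_image_le (d := 1) zero_le_one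
  rw [hausdorffMeasure_real, hm] at this
  simpa using this

/-- a face has countably many extreme points -/
lemma face_countable (f ψ : Z →L[ℝ] ℝ) (hinj : ∀ x y, f x = f y → ψ x = ψ y → x = y)
    (K : Set Z) (r : ℝ) :
    (Set.extremePoints ℝ K ∩ {z | f z = r}).Countable := by
  set S := Set.extremePoints ℝ K ∩ {z | f z = r} with hS
  have hsub : S ⊆ {y | y ∈ S ∧ ∀ x ∈ S, ψ y ≤ ψ x} ∪ {y | y ∈ S ∧ ∀ x ∈ S, ψ x ≤ ψ y} := by
    intro y hy
    by_contra hcon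
    simp only [Set.mem_union, Set.mem_setOf_eq, hy, true_and, not_or, not_forall, not_le] at hcon
    obtain ⟨⟨x, hx, hxy⟩, w, hw, hyw⟩ := hcon
    have hpos : 0 < ψ w - ψ x := by linarith
    have hmem : y ∈ openSegment ℝ x w := by
      refine ⟨(ψ w - ψ y) / (ψ w - ψ x), (ψ y - ψ x) / (ψ w - ψ x),
        div_pos (by linarith) hpos, div_pos (by linarith) hpos, by field_simp; ring, ?_⟩
      apply hinj
      · have e1 : f x = r := hx.2
        have e2 : f w = r := hw.2
        have e3 : f y = r := hy.2
        simp only [map_add, map_smul, smul_eq_mul, e1, e2, e3]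
        field_simp; ring
      · simp only [map_add, map_smul, smul_eq_mul]
        field_simp; ring
    have := (mem_extremePoints.mp hy.1).2 x hx.1.1 w hw.1.1 hmem
    rw [this.1] at hxy
    exact lt_irrefl _ hxy
  refine Set.Countable.mono hsub (Set.Countable.union ?_ ?_)
  · apply Set.Subsingleton.countable
    rintro x ⟨hx, hx'⟩ y ⟨hy, hy'⟩
    exact hinj x y (hx.2.trans hy.2.symm) (le_antisymm (hx' y hy) (hy' x hx))
  · apply Set.Subsingleton.countable
    rintro x ⟨hx, hx'⟩ y ⟨hy, hy'⟩
    exact hinj x y (hx.2.trans hy.2.symm) (le_antisymm (hy' x hx) (hx' y hy))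

/-- generic exposed points -/
lemma dual_le (w : ℕ → Z) (hn : ∀ φ : Z →L[ℝ] ℝ, HasSum (fun n => |φ (w n)|) ‖φ‖)
    (φ : Z →L[ℝ] ℝ) (hφ : ∀ n, w n ≠ 0 → φ (w n) ≠ 0) (z : Z) (hz1 : ‖z‖ ≤ 1)
    (hz : φ z = ‖φ‖) (ψ : Z →L[ℝ] ℝ) :
    ψ z ≤ ∑' n, SignType.sign (φ (w n)) * ψ (w n) := by
  have key : ∀ s : ℝ, 0 < s →
      ψ z ≤ ∑' n, (|φ (w n) + s * ψ (w n)| - |φ (w n)|) / s := by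
    intro s hs
    have h1 := hn (φ + s • ψ)
    have h2 := ((h1.sub (hn φ)).div_const s).tsum_eq
    simp only [add_apply, smul_apply, smul_eq_mul] at h2
    rw [h2, le_div_iff₀ hs]
    have h3 : (φ + s • ψ) z ≤ ‖φ + s • ψ‖ :=
      (le_abs_self _).trans (((φ + s • ψ).le_opNorm z).trans
        (mul_le_of_le_one_right (norm_nonneg _) hz1))
    simp only [add_apply, smul_apply, smul_eq_mul] at h3
    linarith
  have hlim : Filter.Tendsto (fun s : ℝ => ∑' n, (|φ (w n) + s * ψ (w n)| - |φ (w n)|) / s)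
      (nhdsWithin 0 (Set.Ioi 0)) (nhds (∑' n, SignType.sign (φ (w n)) * ψ (w n))) := by
    refine tendsto_tsum_of_dominated_convergence (bound := fun n => |ψ (w n)|)
      (hn ψ).summable ?_ ?_
    · intro n
      by_cases h0 : w n = 0
      · simp [h0]
      have ha := hφ n h0
      have hd : HasDerivAt (fun s : ℝ => |φ (w n) + s * ψ (w n)|)
          (SignType.sign (φ (w n)) * ψ (w n)) 0 := by
        have i1 : HasDerivAt (fun s : ℝ => φ (w n) + s * ψ (w n)) (ψ (w n)) 0 := by
          simpa using ((hasDerivAt_id (0:ℝ)).mul_const (ψ (w n))).const_add (φ (w n))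
        have i2 : HasDerivAt (fun x : ℝ => |x|) (SignType.sign (φ (w n)) : ℝ)
            (φ (w n) + 0 * ψ (w n)) := by
          simpa using hasDerivAt_abs ha
        exact i2.comp (0:ℝ) i1
      have := (hd.tendsto_slope).mono_left
        (nhdsWithin_mono (0:ℝ) (show Set.Ioi (0:ℝ) ⊆ {0}ᶜ from fun x hx => ne_of_gt hx))
      refine this.congr fun s => ?_
      simp [slope_def_field]
    · filter_upwards [self_mem_nhdsWithin] with s hs n
      have hs : 0 < s := hs
      rw [norm_div, Real.norm_eq_abs, Real.norm_of_nonneg hs.le, div_le_iff₀ hs]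
      refine (abs_abs_sub_abs_le_abs_sub _ _).trans ?_
      rw [add_sub_cancel_left, abs_mul, abs_of_pos hs, mul_comm]
  refine ge_of_tendsto hlim ?_
  filter_upwards [self_mem_nhdsWithin] with s hs using key s hs

lemma dual_eq (w : ℕ → Z) (hn : ∀ φ : Z →L[ℝ] ℝ, HasSum (fun n => |φ (w n)|) ‖φ‖)
    (φ : Z →L[ℝ] ℝ) (hφ : ∀ n, w n ≠ 0 → φ (w n) ≠ 0) (z : Z) (hz1 : ‖z‖ ≤ 1)
    (hz : φ z = ‖φ‖) (ψ : Z →L[ℝ] ℝ) :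
    ψ z = ∑' n, SignType.sign (φ (w n)) * ψ (w n) := by
  apply le_antisymm (dual_le w hn φ hφ z hz1 hz ψ)
  have h := dual_le w hn φ hφ z hz1 hz (-ψ)
  simp only [neg_apply, mul_neg, tsum_neg] at h
  linarith

lemma scale_norming (φ χ : Z →L[ℝ] ℝ) (c : ℝ) (hc : c ≠ 0) (h : φ = c • χ) (z : Z)
    (hz : φ z = ‖φ‖) : χ z = ‖χ‖ ∨ χ (-z) = ‖χ‖ := by
  rw [h, norm_smul, smul_apply, smul_eq_mul, Real.norm_eq_abs] at hz
  rcases abs_cases c with ⟨h1, _⟩ | ⟨h1, _⟩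
  · left; rw [h1] at hz; exact mul_left_cancel₀ hc hz
  · right; rw [h1] at hz; apply mul_left_cancel₀ hc; rw [map_neg]; linarith

/-- The theorem for a space with given coordinates `f`, `g` and generating vectors `w`. -/
lemma main [MeasurableSpace Z] [BorelSpace Z] [Nontrivial Z] [CompleteSpace Z]
    (f g : Z →L[ℝ] ℝ)
    (hinj : ∀ x y, f x = f y → g x = g y → x = y)
    (hspan : ∀ φ : Z →L[ℝ] ℝ, ∃ a b : ℝ, φ = a • f + b • g)
    (w : ℕ → Z) (hn : ∀ φ : Z →L[ℝ] ℝ, HasSum (fun n => |φ (w n)|) ‖φ‖)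
    (hw : Summable fun n => ‖w n‖) (hg : ∀ n, 0 ≤ g (w n)) :
    μH[1] (Set.extremePoints ℝ (Metric.closedBall (0 : Z) 1)) = 0 := by
  classical
  haveI := Measure.nullSingletonClass_hausdorff Z (d := 1) one_pos
  let P : ℕ → ℝ → Prop := fun n t => 0 < f (w n) + t * g (w n)
  let σ : ℕ → ℝ → ℝ := fun n t => if P n t then 1 else -1
  have hP : ∀ n s t, s ≤ t → P n s → P n t := by
    intro n s t hst h
    have := mul_le_mul_of_nonneg_right hst (hg n)
    simp only [P] at h ⊢
    linarith
  have h1 : ∀ n t, P n t → σ n t = 1 := fun n t h => if_pos h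
  have h2 : ∀ n t, ¬ P n t → σ n t = -1 := fun n t h => if_neg h
  have habs : ∀ n t, |σ n t| = 1 := by
    intro n t
    by_cases h : P n t
    · simp [h1 n t h]
    · simp [h2 n t h]
  have hmono : ∀ n, Monotone (σ n) := by
    intro n s t hst
    by_cases h : P n s
    · rw [h1 n s h, h1 n t (hP n s t hst h)]
    · rw [h2 n s h]; exact (abs_le.mp (habs n t).le).1
  let m : ℝ → ℝ := fun t => ∑' n, σ n t * ‖w n‖
  have hm : volume (Set.range m) = 0 := jump_null _ (fun n => norm_nonneg _) hw P hP σ h1 h2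
  let F : ℝ → Z := fun t => ∑' n, σ n t • w n
  have hFs : ∀ t, Summable fun n => σ n t • w n := fun t =>
    Summable.of_norm_bounded hw fun n => by rw [norm_smul, Real.norm_eq_abs, habs, one_mul]
  have hms : ∀ t, Summable fun n => σ n t * ‖w n‖ := fun t =>
    Summable.of_norm_bounded hw fun n => by
      rw [norm_mul, Real.norm_eq_abs, habs, one_mul, norm_norm]
  have hdist' : ∀ s t, s ≤ t → dist (F s) (F t) ≤ dist (m s) (m t) := by
    intro s t hst
    rw [dist_comm, dist_comm (m s), dist_eq_norm, Real.dist_eq]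
    refine le_trans ?_ (le_abs_self _)
    simp only [F, m]
    rw [← (hFs t).tsum_sub (hFs s), ← (hms t).tsum_sub (hms s)]
    refine tsum_of_norm_bounded ((hms t).sub (hms s)).hasSum fun n => ?_
    rw [← sub_smul, norm_smul, ← sub_mul, Real.norm_of_nonneg (sub_nonneg.mpr (hmono n hst))]
  have hdist : ∀ s t, dist (F s) (F t) ≤ dist (m s) (m t) := by
    intro s t
    rcases le_total s t with h | h
    · exact hdist' s t h
    · rw [dist_comm, dist_comm (m s)]; exact hdist' t s h
  have hF : μH[1] (Set.range F) = 0 := range_null F m hm hdist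
  have hF' : μH[1] (Set.range fun t => - F t) = 0 :=
    range_null _ m hm fun s t => by rw [dist_neg_neg]; exact hdist s t
  -- the generic case
  have hgen : ∀ t : ℝ, (∀ n, w n ≠ 0 → f (w n) + t * g (w n) ≠ 0) → ∀ z : Z, ‖z‖ ≤ 1 →
      (f + t • g) z = ‖f + t • g‖ → z = F t := by
    intro t ht z hz1 hz
    have hψ : ∀ ψ : Z →L[ℝ] ℝ, ψ z = ψ (F t) := by
      intro ψ
      rw [dual_eq w hn (f + t • g) (fun n h => by simpa using ht n h) z hz1 hz ψ]
      simp only [F]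
      rw [ψ.map_tsum (hFs t)]
      congr 1
      ext n
      by_cases h0 : w n = 0
      · simp [h0]
      rw [map_smul, smul_eq_mul]
      congr 1
      simp only [add_apply, smul_apply, smul_eq_mul]
      by_cases h : P n t
      · rw [h1 n t h, sign_pos h]; simp
      · have hlt : f (w n) + t * g (w n) < 0 := lt_of_le_of_ne (not_lt.mp h) (ht n h0)
        rw [h2 n t h, sign_neg hlt]; simp
    exact hinj _ _ (hψ f) (hψ g)
  -- exceptional directions
  let T : Set ℝ := ⋃ n, {t | w n ≠ 0 ∧ f (w n) + t * g (w n) = 0}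
  have hT : T.Countable := by
    refine Set.countable_iUnion fun n => Set.Subsingleton.countable ?_
    rintro s ⟨h0, hs⟩ t ⟨_, ht⟩
    have hg0 : g (w n) ≠ 0 := by
      intro h
      rw [h, mul_zero, add_zero] at hs
      exact h0 (hinj _ _ (by rw [hs, map_zero]) (by rw [h, map_zero]))
    exact mul_right_cancel₀ hg0 (by linarith)
  set E := Set.extremePoints ℝ (Metric.closedBall (0 : Z) 1) with hE
  let C : Set Z := ((E ∩ {z | g z = ‖g‖}) ∪ (E ∩ {z | g z = -‖g‖})) ∪
    ⋃ t ∈ T, ((E ∩ {z | (f + t • g) z = ‖f + t • g‖}) ∪ (E ∩ {z | (f + t • g) z = -‖f + t • g‖}))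
  have hC : C.Countable := by
    have hi1 : ∀ x y, g x = g y → f x = f y → x = y := fun x y a b => hinj x y b a
    have hi2 : ∀ t : ℝ, ∀ x y, (f + t • g) x = (f + t • g) y → g x = g y → x = y := by
      intro t x y a b
      simp only [add_apply, smul_apply, smul_eq_mul, b] at a
      exact hinj x y (by linarith) b
    refine ((face_countable g f hi1 _ _).union (face_countable g f hi1 _ _)).union ?_
    exact hT.biUnion fun t _ =>
      (face_countable _ g (hi2 t) _ _).union (face_countable _ g (hi2 t) _ _)
  have hsub : E ⊆ (Set.range F ∪ Set.range fun t => - F t) ∪ C := by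
    intro z hzE
    have hz1 : ‖z‖ = 1 := by simpa using extremePoints_closedBall_subset_sphere hzE
    obtain ⟨φ, hφ1, hφz⟩ := exists_dual_vector ℝ z (by rw [hz1]; exact one_ne_zero)
    have hφ : φ z = ‖φ‖ := by rw [hφ1, hφz, hz1]; rfl
    obtain ⟨a, b, hab⟩ := hspan φ
    by_cases ha : a = 0
    · have hb : b ≠ 0 := by
        rintro rfl
        rw [ha, zero_smul, zero_smul, add_zero] at hab
        rw [hab, norm_zero] at hφ1
        exact zero_ne_one hφ1
      right; left
      rcases scale_norming φ g b hb (by rw [hab, ha]; simp) z hφ with h | h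
      · left; exact ⟨hzE, h⟩
      · right; refine ⟨hzE, ?_⟩
        rw [map_neg] at h
        change g z = -‖g‖
        linarith
    · have hsc := scale_norming φ (f + (b / a) • g) a ha
        (by rw [hab, smul_add, smul_smul, mul_div_cancel₀ _ ha]) z hφ
      set t := b / a
      by_cases htT : t ∈ T
      · right; right
        refine Set.mem_biUnion htT ?_
        rcases hsc with h | h
        · left; exact ⟨hzE, h⟩
        · right; refine ⟨hzE, ?_⟩
          rw [map_neg] at h
          change (f + t • g) z = -‖f + t • g‖
          linarith
      · left
        have ht : ∀ n, w n ≠ 0 → f (w n) + t * g (w n) ≠ 0 := fun n h0 h =>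
          htT (Set.mem_iUnion.mpr ⟨n, h0, h⟩)
        rcases hsc with h | h
        · left; exact ⟨t, (hgen t ht z hz1.le h).symm⟩
        · right
          refine ⟨t, ?_⟩
          have := hgen t ht (-z) (by rw [norm_neg]; exact hz1.le) h
          change - F t = z
          rw [← this, neg_neg]
  exact measure_mono_null hsub
    (measure_union_null (measure_union_null hF hF') (hC.measure_zero _))

end

end Stmt14

/-- If `Z` is a 2-dimensional Banach space whose dual `Z*` embeds isometrically
into `ℓ¹`, then the set of extreme points of the unit ball of `Z` has linear (1-dimensional
Hausdorff) measure zero. -/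
theorem stmt_14 {Z : Type*} [NormedAddCommGroup Z] [NormedSpace ℝ Z]
    [MeasurableSpace Z] [BorelSpace Z]
    (hdim : Module.finrank ℝ Z = 2)
    (hemb : Nonempty ((Z →L[ℝ] ℝ) →ₗᵢ[ℝ] lp (fun _ : ℕ => ℝ) 1)) :
    μH[1] (Set.extremePoints ℝ (Metric.closedBall (0 : Z) 1)) = 0 := by
  classical
  obtain ⟨i⟩ := hemb
  haveI : FiniteDimensional ℝ Z := Module.finite_of_finrank_pos (by omega)
  haveI : Nontrivial Z := Module.nontrivial_of_finrank_pos (R := ℝ) (by omega)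
  haveI : CompleteSpace Z := FiniteDimensional.complete ℝ Z
  let e : Z ≃L[ℝ] ℝ × ℝ := ContinuousLinearEquiv.ofFinrankEq (by simp [hdim])
  let f : Z →L[ℝ] ℝ := (ContinuousLinearMap.fst ℝ ℝ ℝ).comp (e : Z →L[ℝ] ℝ × ℝ)
  let g : Z →L[ℝ] ℝ := (ContinuousLinearMap.snd ℝ ℝ ℝ).comp (e : Z →L[ℝ] ℝ × ℝ)
  have hf : ∀ x, f x = (e x).1 := fun x => rfl
  have hg : ∀ x, g x = (e x).2 := fun x => rfl
  have hspan : ∀ φ : Z →L[ℝ] ℝ, φ = φ (e.symm (1, 0)) • f + φ (e.symm (0, 1)) • g := by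
    intro φ
    ext x
    have hx : x = (e x).1 • e.symm (1, 0) + (e x).2 • e.symm (0, 1) := by
      apply e.injective
      simp
    simp only [add_apply, smul_apply, smul_eq_mul, hf, hg]
    conv_lhs => rw [hx]
    simp only [map_add, map_smul, smul_eq_mul]
    ring
  let z : ℕ → Z := fun n => e.symm (i f n, i g n)
  have hz : ∀ (φ : Z →L[ℝ] ℝ) n, i φ n = φ (z n) := by
    intro φ n
    rw [hspan φ]
    simp [z, hf, hg]
    rfl
  let w : ℕ → Z := fun n => if 0 ≤ g (z n) then z n else - z n
  have hwabs : ∀ (φ : Z →L[ℝ] ℝ) n, |φ (w n)| = |φ (z n)| := by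
    intro φ n
    simp only [w]
    split_ifs <;> simp
  have hn : ∀ φ : Z →L[ℝ] ℝ, HasSum (fun n => |φ (w n)|) ‖φ‖ := by
    intro φ
    have := lp.hasSum_norm (p := 1) (by simp) (i φ)
    simp only [ENNReal.toReal_one, Real.rpow_one, i.norm_map, Real.norm_eq_abs, hz] at this
    simpa only [hwabs] using this
  refine Stmt14.main f g ?_ (fun φ => ⟨_, _, hspan φ⟩) w hn ?_ ?_
  · intro x y h1 h2
    exact e.injective (Prod.ext h1 h2)
  · refine Summable.of_nonneg_of_le (fun n => norm_nonneg _) (fun n => ?_)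
      (((hn f).summable.add (hn g).summable).mul_left ‖(e.symm : ℝ × ℝ →L[ℝ] Z)‖)
    have h := (e.symm : ℝ × ℝ →L[ℝ] Z).le_opNorm (e (w n))
    simp only [ContinuousLinearEquiv.coe_coe, ContinuousLinearEquiv.symm_apply_apply] at h
    refine h.trans (mul_le_mul_of_nonneg_left ?_ (norm_nonneg _))
    rw [Prod.norm_def]
    exact max_le (le_add_of_nonneg_right (abs_nonneg _)) (le_add_of_nonneg_left (abs_nonneg _))
  · intro n
    simp only [w]
    split_ifs with h
    · exact h
    · rw [map_neg]; linarith
end
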